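/- arXiv:2601.21319 — 16 statements merged into one kernel-verified Lean document; each statement's English description precedes it below -/
import Mathlib

section
/- For every Coalitional General Lotto game G = (φ₁, φ₂, X₁, X₂) ∈ ℝ⁴₍₊₎, the maximum collective payoff achievable by budget transfers alone, by contest transfers alone, and by joint transfers all coincide: sup over τ ∈ (−X₂, X₁) of [U₁(τ,0 | G) + U₂(τ,0 | G)] = sup over (τ,ν) ∈ (−X₂, X₁) × (−φ₂, φ₁) of [U₁(τ,ν | G) + U₂(τ,ν | G)] = sup over ν ∈ (−φ₂, φ₁) of [U₁(0,ν | G) + U₂(0,ν | G)]. -/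
open Real Set

/-- Equilibrium payoffs `(Uᵢ, U₋ᵢ)` for the ordered case `x̄₁ φ̄₂ ≤ x̄₂ φ̄₁`:
the first component is the payoff of the player with the smaller
budget-to-valuation ratio (arguments `p1`, `x1`), the second that of the other
player (arguments `p2`, `x2`); `S` is the pre-transfer total budget `X₁ + X₂`. -/
noncomputable def basePayoff (S p1 p2 x1 x2 : ℝ) : ℝ × ℝ :=
  if x1 * p2 = x2 * p1 ∧ 1 ≤ S then
    -- Case 4
    (p1 * (1 - 1 / (2 * S)), p2 * (1 - 1 / (2 * S)))
  else if p2 ≤ x1 * x2 * p1 then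
    -- Case 1
    ((if x1 < 1 then p1 * x1 / 2 else p1 * (1 - 1 / (2 * x1))), p2)
  else if 0 < 1 - Real.sqrt (x1 * x2 * p1 / p2) ∧
      1 - Real.sqrt (x1 * x2 * p1 / p2) ≤ x2 then
    -- Case 2
    ((1 / 2) * Real.sqrt (x1 * p1 * p2 / x2),
      p2 * (1 - 1 / (2 * x2)) + (1 / 2) * Real.sqrt (x1 * p1 * p2 / x2))
  else
    -- Case 3
    ((1 / 2) * x1 * p1 + (1 / 2) * Real.sqrt (x1 * x2 * p1 * p2),
      (1 / 2) * x2 * p2 + (1 / 2) * Real.sqrt (x1 * x2 * p1 * p2))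

/-- Post-transfer payoffs `(U₁(τ,ν | G), U₂(τ,ν | G))` in the Coalitional General
Lotto game `G = (φ₁, φ₂, X₁, X₂)` after a budget transfer `τ` and a contest
transfer `ν` from Player 1 to Player 2. -/
noncomputable def payoffs (phi1 phi2 X1 X2 tau nu : ℝ) : ℝ × ℝ :=
  if (X1 - tau) * (phi2 + nu) ≤ (X2 + tau) * (phi1 - nu) then
    basePayoff (X1 + X2) (phi1 - nu) (phi2 + nu) (X1 - tau) (X2 + tau)
  else
    (basePayoff (X1 + X2) (phi2 + nu) (phi1 - nu) (X2 + tau) (X1 - tau)).swap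

/-- Player 1's post-transfer payoff `U₁(τ,ν | G)`. -/
noncomputable def U1 (phi1 phi2 X1 X2 tau nu : ℝ) : ℝ :=
  (payoffs phi1 phi2 X1 X2 tau nu).1

/-- Player 2's post-transfer payoff `U₂(τ,ν | G)`. -/
noncomputable def U2 (phi1 phi2 X1 X2 tau nu : ℝ) : ℝ :=
  (payoffs phi1 phi2 X1 X2 tau nu).2

/-- The collective payoff `U₁ + U₂` of a transfer `(τ, ν)`. -/
noncomputable def colPayoff (phi1 phi2 X1 X2 tau nu : ℝ) : ℝ :=
  U1 phi1 phi2 X1 X2 tau nu + U2 phi1 phi2 X1 X2 tau nu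

/-- The optimal collective payoff of a coalition with total budget `S` and total contest value
`v`. -/
noncomputable def optimalValue (S v : ℝ) : ℝ :=
  if 1 ≤ S then v * (1 - 1 / (2 * S)) else v * S / 2

lemma mul_one_sub_one_div_two_mul {S : ℝ} (hS : 0 < S) (v : ℝ) :
    v * (1 - 1 / (2 * S)) = v * (2 * S - 1) / (2 * S) := by
  field_simp

/-- The bound when player 1's budget is below the adversary's and player 2 secures all of its
contests. -/
lemma le_optimalValue_of_lt_one {p1 p2 x1 x2 : ℝ} (hp1 : 0 < p1) (hx1 : 0 < x1) (hx2 : 0 < x2)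
    (h : p2 ≤ x1 * x2 * p1) (hlt : x1 < 1) :
    p1 * x1 / 2 + p2 ≤ optimalValue (x1 + x2) (p1 + p2) := by
  unfold optimalValue
  split_ifs with hS
  · rw [mul_one_sub_one_div_two_mul (by positivity), le_div_iff₀ (by positivity)]
    have : 0 ≤ p1 * ((1 - x1) * (2 * (x1 + x2) - 1 - x1)) :=
      mul_nonneg hp1.le (mul_nonneg (by linarith) (by linarith))
    nlinarith
  · have h1 : p2 * (2 - (x1 + x2)) ≤ x1 * x2 * p1 * (2 - (x1 + x2)) :=
      mul_le_mul_of_nonneg_right h (by linarith)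
    have h2 : 0 ≤ p1 * x2 * ((1 - x1) ^ 2 + x1 * x2) := by positivity
    nlinarith

lemma le_optimalValue_of_one_le {p1 p2 x1 x2 : ℝ} (hx2 : 0 < x2)
    (hord : x1 * p2 ≤ x2 * p1) (hge : 1 ≤ x1) :
    p1 * (1 - 1 / (2 * x1)) + p2 ≤ optimalValue (x1 + x2) (p1 + p2) := by
  have hx1 : 0 < x1 := by linarith
  rw [optimalValue, if_pos (by linarith)]
  have h : (p1 + p2) / (2 * (x1 + x2)) ≤ p1 / (2 * x1) := by
    rw [div_le_div_iff₀ (by positivity) (by positivity)]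
    linarith
  calc p1 * (1 - 1 / (2 * x1)) + p2 = p1 + p2 - p1 / (2 * x1) := by ring
    _ ≤ p1 + p2 - (p1 + p2) / (2 * (x1 + x2)) := by linarith
    _ = (p1 + p2) * (1 - 1 / (2 * (x1 + x2))) := by ring

/-- The interior case, with `q = √(x1 x2 p1 / p2)`. -/
lemma le_optimalValue_of_sq_eq {p1 p2 x1 x2 q : ℝ} (hp2 : 0 < p2) (hx1 : 0 < x1) (hx2 : 0 < x2)
    (hq : q ^ 2 * p2 = x1 * x2 * p1) (hxq : x1 ≤ q) :
    p2 * (1 - 1 / (2 * x2)) + p2 * q / x2 ≤ optimalValue (x1 + x2) (p1 + p2) := by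
  have hp1 : p1 = q ^ 2 * p2 / (x1 * x2) := by
    field_simp
    linarith
  have hlhs : p2 * (1 - 1 / (2 * x2)) + p2 * q / x2 = p2 * (2 * x2 - 1 + 2 * q) / (2 * x2) := by
    field_simp
  have hv : p1 + p2 = p2 * (q ^ 2 + x1 * x2) / (x1 * x2) := by
    rw [hp1]
    field_simp
  rw [hlhs, hv]
  unfold optimalValue
  split_ifs with hS
  · rw [mul_one_sub_one_div_two_mul (by positivity), div_mul_eq_mul_div, div_div,
      div_le_div_iff₀ (by positivity) (by positivity)]
    have h : 0 ≤ (q - x1) * ((2 * (x1 + x2) - 1) * q - x1) :=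
      mul_nonneg (by linarith) (by nlinarith)
    have : 0 ≤ 2 * (x2 * p2) * ((q - x1) * ((2 * (x1 + x2) - 1) * q - x1)) := by positivity
    linear_combination this
  · rw [div_mul_eq_mul_div, div_div, div_le_div_iff₀ (by positivity) (by positivity)]
    have h : 0 ≤ (x1 + x2) * q ^ 2 - 2 * x1 * q + x1 + x1 * x2 * (x1 + x2 - 2) := by
      have : 0 ≤ ((x1 + x2) * q - x1) ^ 2 + x1 * x2 * (1 - (x1 + x2)) ^ 2 := by positivity
      refine nonneg_of_mul_nonneg_right (a := x1 + x2) ?_ (by positivity)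
      linear_combination this
    have : 0 ≤ 2 * (x2 * p2) *
        ((x1 + x2) * q ^ 2 - 2 * x1 * q + x1 + x1 * x2 * (x1 + x2 - 2)) := by positivity
    linear_combination this

lemma le_optimalValue_of_lt {p1 p2 x1 x2 : ℝ} (hp1 : 0 < p1) (hp2 : 0 < p2) (hx1 : 0 < x1)
    (hx2 : 0 < x2) (hS : x1 + x2 < 1) :
    x1 * p1 / 2 + x2 * p2 / 2 + √(x1 * x2 * p1 * p2) ≤ optimalValue (x1 + x2) (p1 + p2) := by
  rw [optimalValue, if_neg (by linarith)]
  have : √(x1 * x2 * p1 * p2) ≤ (x1 * p2 + x2 * p1) / 2 := by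
    apply Real.sqrt_le_iff.2 ⟨by positivity, ?_⟩
    nlinarith [sq_nonneg (x1 * p2 - x2 * p1)]
  linarith

lemma basePayoff_add_le {p1 p2 x1 x2 : ℝ} (hp1 : 0 < p1) (hp2 : 0 < p2) (hx1 : 0 < x1)
    (hx2 : 0 < x2) (hord : x1 * p2 ≤ x2 * p1) :
    (basePayoff (x1 + x2) p1 p2 x1 x2).1 + (basePayoff (x1 + x2) p1 p2 x1 x2).2 ≤
      optimalValue (x1 + x2) (p1 + p2) := by
  set q := √(x1 * x2 * p1 / p2) with hqdef
  have hq0 : 0 ≤ q := Real.sqrt_nonneg _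
  have hq : q ^ 2 * p2 = x1 * x2 * p1 := by
    rw [hqdef, Real.sq_sqrt (by positivity)]
    field_simp
  have hxq : x1 ≤ q := by
    apply Real.le_sqrt_of_sq_le
    rw [le_div_iff₀ hp2]
    nlinarith
  unfold basePayoff
  rw [← hqdef]
  split_ifs with h4 h1 hx h2
  · rw [optimalValue, if_pos h4.2]
    linarith
  · exact le_optimalValue_of_lt_one hp1 hx1 hx2 h1 hx
  · exact le_optimalValue_of_one_le hx2 hord (not_lt.1 hx)
  · have hs : √(x1 * p1 * p2 / x2) = p2 * q / x2 := by
      rw [Real.sqrt_eq_iff_mul_self_eq (by positivity) (by positivity)]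
      field_simp
      linarith
    have := le_optimalValue_of_sq_eq hp2 hx1 hx2 hq hxq
    simp only [hs]
    linarith
  · have hq1 : q < 1 := by
      by_contra! h
      exact h1 (hq ▸ le_mul_of_one_le_left hp2.le (one_le_pow₀ h))
    have hS : x1 + x2 < 1 := by
      by_contra! h
      exact h2 ⟨by linarith, by linarith⟩
    have := le_optimalValue_of_lt hp1 hp2 hx1 hx2 hS
    simp only
    linarith

lemma basePayoff_add_eq {p1 p2 x1 x2 : ℝ} (hp2 : 0 < p2) (hx1 : 0 < x1) (hx2 : 0 < x2)
    (hord : x1 * p2 = x2 * p1) :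
    (basePayoff (x1 + x2) p1 p2 x1 x2).1 + (basePayoff (x1 + x2) p1 p2 x1 x2).2 =
      optimalValue (x1 + x2) (p1 + p2) := by
  have hprod : x1 * x2 * p1 = x1 ^ 2 * p2 := by linear_combination -x1 * hord
  have hq : √(x1 * x2 * p1 / p2) = x1 := by
    rw [hprod, mul_div_cancel_right₀ _ hp2.ne', Real.sqrt_sq hx1.le]
  have hs : √(x1 * x2 * p1 * p2) = x1 * p2 := by
    rw [hprod, show x1 ^ 2 * p2 * p2 = (x1 * p2) ^ 2 by ring, Real.sqrt_sq (by positivity)]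
  unfold basePayoff optimalValue
  rw [hq, hs]
  by_cases hS : 1 ≤ x1 + x2
  · rw [if_pos ⟨hord, hS⟩, if_pos hS]
    ring
  · have h1 : ¬p2 ≤ x1 * x2 * p1 := by
      rw [hprod, not_le]
      have : x1 ^ 2 < 1 := by nlinarith
      nlinarith
    rw [if_neg (fun h => hS h.2), if_neg h1, if_neg (fun h => hS (by linarith [h.2])), if_neg hS]
    linear_combination hord / 2

lemma colPayoff_le {phi1 phi2 X1 X2 tau nu : ℝ} (htau : tau ∈ Ioo (-X2) X1)
    (hnu : nu ∈ Ioo (-phi2) phi1) :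
    colPayoff phi1 phi2 X1 X2 tau nu ≤ optimalValue (X1 + X2) (phi1 + phi2) := by
  have hp1 : 0 < phi1 - nu := by linarith [hnu.2]
  have hp2 : 0 < phi2 + nu := by linarith [hnu.1]
  have hx1 : 0 < X1 - tau := by linarith [htau.2]
  have hx2 : 0 < X2 + tau := by linarith [htau.1]
  unfold colPayoff U1 U2 payoffs
  split_ifs with h
  · have := basePayoff_add_le hp1 hp2 hx1 hx2 h
    rwa [show X1 - tau + (X2 + tau) = X1 + X2 by ring,
      show phi1 - nu + (phi2 + nu) = phi1 + phi2 by ring] at this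
  · have := basePayoff_add_le hp2 hp1 hx2 hx1 (not_le.1 h).le
    rw [show X2 + tau + (X1 - tau) = X1 + X2 by ring,
      show phi2 + nu + (phi1 - nu) = phi1 + phi2 by ring] at this
    simp only [Prod.fst_swap, Prod.snd_swap]
    linarith

/-- Equalizing the budget-to-value ratios of the two players is optimal. -/
lemma colPayoff_eq {phi1 phi2 X1 X2 tau nu : ℝ} (htau : tau ∈ Ioo (-X2) X1)
    (hnu : nu ∈ Ioo (-phi2) phi1)
    (h : (X1 - tau) * (phi2 + nu) = (X2 + tau) * (phi1 - nu)) :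
    colPayoff phi1 phi2 X1 X2 tau nu = optimalValue (X1 + X2) (phi1 + phi2) := by
  unfold colPayoff U1 U2 payoffs
  rw [if_pos h.le]
  have := basePayoff_add_eq (by linarith [hnu.1]) (by linarith [htau.2]) (by linarith [htau.1]) h
  rwa [show X1 - tau + (X2 + tau) = X1 + X2 by ring,
    show phi1 - nu + (phi2 + nu) = phi1 + phi2 by ring] at this

/-- **Theorem (Equivalence of transfer types).** For every Coalitional General
Lotto game `G = (φ₁, φ₂, X₁, X₂) ∈ ℝ⁴₍₊₎`, the supremum of the collective payoff
over budget transfers alone, over joint transfers, and over contest transfers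
alone all coincide. -/
theorem collective_payoff_equivalence (phi1 phi2 X1 X2 : ℝ)
    (hphi1 : 0 < phi1) (hphi2 : 0 < phi2) (hX1 : 0 < X1) (hX2 : 0 < X2) :
    sSup ((fun tau => colPayoff phi1 phi2 X1 X2 tau 0) '' Set.Ioo (-X2) X1) =
      sSup ((fun p : ℝ × ℝ => colPayoff phi1 phi2 X1 X2 p.1 p.2) ''
        (Set.Ioo (-X2) X1 ×ˢ Set.Ioo (-phi2) phi1)) ∧
    sSup ((fun p : ℝ × ℝ => colPayoff phi1 phi2 X1 X2 p.1 p.2) ''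
        (Set.Ioo (-X2) X1 ×ˢ Set.Ioo (-phi2) phi1)) =
      sSup ((fun nu => colPayoff phi1 phi2 X1 X2 0 nu) '' Set.Ioo (-phi2) phi1) := by
  set V := optimalValue (X1 + X2) (phi1 + phi2)
  have h0X : (0 : ℝ) ∈ Ioo (-X2) X1 := ⟨by linarith, hX1⟩
  have h0phi : (0 : ℝ) ∈ Ioo (-phi2) phi1 := ⟨by linarith, hphi1⟩
  obtain ⟨tau, htau, htau_eq⟩ : ∃ tau ∈ Ioo (-X2) X1, colPayoff phi1 phi2 X1 X2 tau 0 = V := by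
    have htau : (X1 * phi2 - X2 * phi1) / (phi1 + phi2) ∈ Ioo (-X2) X1 := by
      constructor
      · rw [lt_div_iff₀ (by positivity)]
        nlinarith
      · rw [div_lt_iff₀ (by positivity)]
        nlinarith
    refine ⟨_, htau, colPayoff_eq htau h0phi ?_⟩
    field_simp
    ring
  obtain ⟨nu, hnu, hnu_eq⟩ : ∃ nu ∈ Ioo (-phi2) phi1, colPayoff phi1 phi2 X1 X2 0 nu = V := by
    have hnu : (X2 * phi1 - X1 * phi2) / (X1 + X2) ∈ Ioo (-phi2) phi1 := by
      constructor
      · rw [lt_div_iff₀ (by positivity)]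
        nlinarith
      · rw [div_lt_iff₀ (by positivity)]
        nlinarith
    refine ⟨_, hnu, colPayoff_eq h0X hnu ?_⟩
    field_simp
    ring
  have hbudget : IsGreatest ((fun tau => colPayoff phi1 phi2 X1 X2 tau 0) '' Ioo (-X2) X1) V :=
    ⟨⟨tau, htau, htau_eq⟩, forall_mem_image.2 fun _ ht => colPayoff_le ht h0phi⟩
  have hjoint : IsGreatest ((fun p : ℝ × ℝ => colPayoff phi1 phi2 X1 X2 p.1 p.2) ''
      (Ioo (-X2) X1 ×ˢ Ioo (-phi2) phi1)) V :=
    ⟨⟨(tau, 0), ⟨htau, h0phi⟩, htau_eq⟩, forall_mem_image.2 fun _ hp => colPayoff_le hp.1 hp.2⟩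
  have hcontest : IsGreatest ((fun nu => colPayoff phi1 phi2 X1 X2 0 nu) '' Ioo (-phi2) phi1) V :=
    ⟨⟨nu, hnu, hnu_eq⟩, forall_mem_image.2 fun _ hn => colPayoff_le h0X hn⟩
  rw [hbudget.csSup_eq, hjoint.csSup_eq, hcontest.csSup_eq]
  exact ⟨rfl, rfl⟩
end

section
/- The common maximum collective payoff over all joint transfers is attained and equals ((2(X₁+X₂) − 1)/(2(X₁+X₂)))·(φ₁ + φ₂) when X₁ + X₂ ≥ 1, and equals ((X₁+X₂)/2)·(φ₁ + φ₂) when X₁ + X₂ < 1; in both cases it is attained by the pure contest transfer ν** = (X₂φ₁ − X₁φ₂)/(X₁ + X₂), which equalizes the Players' post-transfer budget-to-valuation ratios. -/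
open Real Set

/-- In the ordered case, the payoffs sum to at most the value obtained when the budget-to-valuation
ratios of the two players coincide. -/
lemma basePayoff_sum_le {p1 p2 x1 x2 : ℝ} (hp1 : 0 < p1) (hp2 : 0 < p2) (hx1 : 0 < x1)
    (hx2 : 0 < x2) (h : x1 * p2 ≤ x2 * p1) :
    (basePayoff (x1 + x2) p1 p2 x1 x2).1 + (basePayoff (x1 + x2) p1 p2 x1 x2).2 ≤
      if 1 ≤ x1 + x2 then (2 * (x1 + x2) - 1) / (2 * (x1 + x2)) * (p1 + p2)
      else (x1 + x2) / 2 * (p1 + p2) := by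
  have hS : 0 < x1 + x2 := by positivity
  unfold basePayoff
  by_cases h4 : x1 * p2 = x2 * p1 ∧ 1 ≤ x1 + x2
  · rw [if_pos h4, if_pos h4.2]
    apply le_of_eq
    field_simp
  rw [if_neg h4]
  by_cases h1 : p2 ≤ x1 * x2 * p1
  · rw [if_pos h1]
    dsimp only
    split_ifs with hx hS1 hS1
    · rw [div_mul_eq_mul_div, le_div_iff₀ (by positivity)]
      nlinarith [mul_nonneg hp1.le
        (mul_nonneg (sub_nonneg.2 hx.le) (show 0 ≤ 2 * x2 - 1 + x1 by linarith))]
    · nlinarith [mul_le_mul_of_nonneg_right h1 (show 0 ≤ 2 - (x1 + x2) by linarith),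
        mul_nonneg (mul_pos hx2 hp1).le (sq_nonneg (1 - x1)), mul_pos (mul_pos hx2 hp1)
        (mul_pos hx1 hx2)]
    · rw [div_mul_eq_mul_div, le_div_iff₀ (by positivity)]
      have key : p1 + p2 ≤ p1 / x1 * (x1 + x2) := by
        rw [div_mul_eq_mul_div, le_div_iff₀ hx1]
        linarith
      have : (p1 * (1 - 1 / (2 * x1)) + p2) * (2 * (x1 + x2)) =
          2 * (x1 + x2) * (p1 + p2) - p1 / x1 * (x1 + x2) := by
        field_simp
        ring
      linarith
    · linarith
  rw [if_neg h1]
  push Not at h1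
  set s := √(x1 * x2 * p1 / p2) with hs
  have hs0 : 0 ≤ s := Real.sqrt_nonneg _
  have hs2 : s ^ 2 = x1 * x2 * p1 / p2 := Real.sq_sqrt (by positivity)
  have hs1 : s < 1 := by
    rw [hs, Real.sqrt_lt' one_pos, one_pow, div_lt_one hp2]
    exact h1
  have hxs : x1 ≤ s := by
    apply Real.le_sqrt_of_sq_le
    rw [le_div_iff₀ hp2]
    nlinarith
  by_cases h2 : 0 < 1 - s ∧ 1 - s ≤ x2
  · rw [if_pos h2]
    have hr : √(x1 * p1 * p2 / x2) = s * p2 / x2 := by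
      rw [Real.sqrt_eq_iff_mul_self_eq (by positivity) (by positivity)]
      symm
      calc s * p2 / x2 * (s * p2 / x2) = s ^ 2 * p2 ^ 2 / x2 ^ 2 := by ring
        _ = x1 * p1 * p2 / x2 := by rw [hs2]; field_simp
    have hp1s : p1 = s ^ 2 * p2 / (x1 * x2) := by
      rw [hs2]
      field_simp
    have hsum : 1 / 2 * (s * p2 / x2) + (p2 * (1 - 1 / (2 * x2)) + 1 / 2 * (s * p2 / x2)) =
        p2 / (2 * x2) * (2 * x2 - 1 + 2 * s) := by
      field_simp
      ring
    have hP : p1 + p2 = p2 / (x1 * x2) * (x1 * x2 + s ^ 2) := by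
      rw [hp1s]
      field_simp
      ring
    rw [hr, hsum, hP]
    split_ifs with hS1
    · have key : 0 ≤ (s - x1) * ((2 * (x1 + x2) - 1) * s - x1) :=
        mul_nonneg (by linarith) (by nlinarith)
      rw [← sub_nonneg]
      have : (2 * (x1 + x2) - 1) / (2 * (x1 + x2)) * (p2 / (x1 * x2) * (x1 * x2 + s ^ 2)) -
          p2 / (2 * x2) * (2 * x2 - 1 + 2 * s) =
          p2 / (2 * x1 * x2 * (x1 + x2)) * ((s - x1) * ((2 * (x1 + x2) - 1) * s - x1)) := by
        field_simp
        ring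
      rw [this]
      positivity
    · rw [← sub_nonneg]
      have : (x1 + x2) / 2 * (p2 / (x1 * x2) * (x1 * x2 + s ^ 2)) -
          p2 / (2 * x2) * (2 * x2 - 1 + 2 * s) =
          p2 / (2 * x1 * x2 * (x1 + x2)) *
            (((x1 + x2) * s - x1) ^ 2 + x1 * x2 * (x1 + x2 - 1) ^ 2) := by
        field_simp
        ring
      rw [this]
      positivity
  · rw [if_neg h2]
    have hx2s : x2 < 1 - s := by
      by_contra! hc
      exact h2 ⟨by linarith, hc⟩
    rw [if_neg (by linarith)]
    have : √(x1 * x2 * p1 * p2) ≤ (x1 * p2 + x2 * p1) / 2 := by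
      rw [Real.sqrt_le_left (by positivity)]
      nlinarith [sq_nonneg (x1 * p2 - x2 * p1)]
    dsimp only
    linarith

/-- Equal budget-to-valuation ratios attain the bound of `basePayoff_sum_le`. -/
lemma basePayoff_sum_eq {p1 p2 x1 x2 : ℝ} (hp1 : 0 < p1) (hp2 : 0 < p2) (hx1 : 0 < x1)
    (hx2 : 0 < x2) (h : x1 * p2 = x2 * p1) :
    (basePayoff (x1 + x2) p1 p2 x1 x2).1 + (basePayoff (x1 + x2) p1 p2 x1 x2).2 =
      if 1 ≤ x1 + x2 then (2 * (x1 + x2) - 1) / (2 * (x1 + x2)) * (p1 + p2)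
      else (x1 + x2) / 2 * (p1 + p2) := by
  unfold basePayoff
  by_cases hS : 1 ≤ x1 + x2
  · rw [if_pos ⟨h, hS⟩, if_pos hS]
    field_simp
  · have h1 : ¬ p2 ≤ x1 * x2 * p1 := by
      rw [mul_assoc, ← h]
      nlinarith [mul_pos hp2 (show 0 < 1 - x1 by linarith), mul_pos hp2 hx1]
    have hs : √(x1 * x2 * p1 / p2) = x1 := by
      rw [mul_assoc, ← h, ← mul_assoc, mul_div_cancel_right₀ _ hp2.ne', Real.sqrt_mul_self hx1.le]
    have hr : √(x1 * x2 * p1 * p2) = x1 * p2 := by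
      rw [mul_assoc x1, ← h, show x1 * (x1 * p2) * p2 = (x1 * p2) * (x1 * p2) by ring,
        Real.sqrt_mul_self (by positivity)]
    rw [if_neg (by tauto), if_neg h1, hs, if_neg (by rintro ⟨-, h3⟩; linarith), hr, if_neg hS]
    linarith

/-- The common maximum collective payoff over all joint transfers is attained by
the pure contest transfer `ν** = (X₂φ₁ − X₁φ₂)/(X₁ + X₂)`, which equalizes the
Players' post-transfer budget-to-valuation ratios, and equals
`((2(X₁+X₂) − 1)/(2(X₁+X₂)))·(φ₁ + φ₂)` when `X₁ + X₂ ≥ 1` and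
`((X₁+X₂)/2)·(φ₁ + φ₂)` when `X₁ + X₂ < 1`. -/
theorem max_collective_payoff_attained (phi1 phi2 X1 X2 : ℝ)
    (hphi1 : 0 < phi1) (hphi2 : 0 < phi2) (hX1 : 0 < X1) (hX2 : 0 < X2)
    (nustar : ℝ) (hnustar : nustar = (X2 * phi1 - X1 * phi2) / (X1 + X2)) :
    nustar ∈ Set.Ioo (-phi2) phi1 ∧
    X1 * (phi2 + nustar) = X2 * (phi1 - nustar) ∧
    (∀ tau ∈ Set.Ioo (-X2) X1, ∀ nu ∈ Set.Ioo (-phi2) phi1,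
      colPayoff phi1 phi2 X1 X2 tau nu ≤ colPayoff phi1 phi2 X1 X2 0 nustar) ∧
    colPayoff phi1 phi2 X1 X2 0 nustar =
      (if 1 ≤ X1 + X2 then
        (2 * (X1 + X2) - 1) / (2 * (X1 + X2)) * (phi1 + phi2)
      else
        (X1 + X2) / 2 * (phi1 + phi2)) := by
  have hS : 0 < X1 + X2 := by positivity
  have hp1 : phi1 - nustar = X1 * (phi1 + phi2) / (X1 + X2) := by
    rw [hnustar]
    field_simp
    ring
  have hp2 : phi2 + nustar = X2 * (phi1 + phi2) / (X1 + X2) := by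
    rw [hnustar]
    field_simp
    ring
  have hpos1 : 0 < phi1 - nustar := by rw [hp1]; positivity
  have hpos2 : 0 < phi2 + nustar := by rw [hp2]; positivity
  have hratio : X1 * (phi2 + nustar) = X2 * (phi1 - nustar) := by
    rw [hp1, hp2]
    ring
  have hval : colPayoff phi1 phi2 X1 X2 0 nustar =
      if 1 ≤ X1 + X2 then (2 * (X1 + X2) - 1) / (2 * (X1 + X2)) * (phi1 + phi2)
      else (X1 + X2) / 2 * (phi1 + phi2) := by
    have := basePayoff_sum_eq hpos1 hpos2 hX1 hX2 hratio
    rw [show phi1 - nustar + (phi2 + nustar) = phi1 + phi2 by ring] at this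
    unfold colPayoff U1 U2 payoffs
    rw [sub_zero, add_zero, if_pos hratio.le, this]
  refine ⟨⟨by linarith, by linarith⟩, hratio, ?_, hval⟩
  rintro tau ⟨ht1, ht2⟩ nu ⟨hn1, hn2⟩
  rw [hval]
  unfold colPayoff U1 U2 payoffs
  by_cases hle : (X1 - tau) * (phi2 + nu) ≤ (X2 + tau) * (phi1 - nu)
  · have := basePayoff_sum_le (by linarith) (by linarith) (by linarith) (by linarith) hle
    rw [show phi1 - nu + (phi2 + nu) = phi1 + phi2 by ring,
      show X1 - tau + (X2 + tau) = X1 + X2 by ring] at this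
    rwa [if_pos hle]
  · have := basePayoff_sum_le (by linarith) (by linarith) (by linarith) (by linarith)
      (not_le.1 hle).le
    rw [show phi2 + nu + (phi1 - nu) = phi1 + phi2 by ring,
      show X2 + tau + (X1 - tau) = X1 + X2 by ring] at this
    rwa [if_neg hle, Prod.fst_swap, Prod.snd_swap, add_comm]
end

section
/- Each of the three sets 𝐆^τ, 𝐆^ν, and 𝐆^{τ,ν} (the sets of Coalitional General Lotto games admitting a mutually beneficial budget transfer, contest transfer, and joint transfer, respectively) is nonempty. -/
open Real Set

/-- A transfer `(τ, ν)` (feasible: `τ ∈ (−X₂, X₁)`, `ν ∈ (−φ₂, φ₁)`) is mutually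
beneficial if it strictly increases both Players' payoffs. -/
def MutuallyBeneficial (phi1 phi2 X1 X2 tau nu : ℝ) : Prop :=
  tau ∈ Set.Ioo (-X2) X1 ∧ nu ∈ Set.Ioo (-phi2) phi1 ∧
  U1 phi1 phi2 X1 X2 tau nu > U1 phi1 phi2 X1 X2 0 0 ∧
  U2 phi1 phi2 X1 X2 tau nu > U2 phi1 phi2 X1 X2 0 0

/-- The set `𝐆` of Coalitional General Lotto games `(φ₁, φ₂, X₁, X₂) ∈ ℝ⁴₍₊₎`. -/
def Games : Set (ℝ × ℝ × ℝ × ℝ) :=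
  {g | 0 < g.1 ∧ 0 < g.2.1 ∧ 0 < g.2.2.1 ∧ 0 < g.2.2.2}

/-- `𝐆^τ`: games admitting a mutually beneficial budget transfer `(τ, 0)`. -/
def GTau : Set (ℝ × ℝ × ℝ × ℝ) :=
  {g ∈ Games | ∃ tau, MutuallyBeneficial g.1 g.2.1 g.2.2.1 g.2.2.2 tau 0}

/-- `𝐆^ν`: games admitting a mutually beneficial contest transfer `(0, ν)`. -/
def GNu : Set (ℝ × ℝ × ℝ × ℝ) :=
  {g ∈ Games | ∃ nu, MutuallyBeneficial g.1 g.2.1 g.2.2.1 g.2.2.2 0 nu}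

/-- `𝐆^{τ,ν}`: games admitting a mutually beneficial joint transfer `(τ, ν)`. -/
def GTauNu : Set (ℝ × ℝ × ℝ × ℝ) :=
  {g ∈ Games | ∃ tau nu, MutuallyBeneficial g.1 g.2.1 g.2.2.1 g.2.2.2 tau nu}

/-- The payoffs without any square root, when both radicands of Case 2 are squares. -/
theorem payoffs_eq_of_sq {phi1 phi2 X1 X2 tau nu : ℝ} (s r : ℝ)
    (hlt : (X1 - tau) * (phi2 + nu) < (X2 + tau) * (phi1 - nu))
    (hcase : (X1 - tau) * (X2 + tau) * (phi1 - nu) < phi2 + nu)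
    (hs : (X1 - tau) * (X2 + tau) * (phi1 - nu) / (phi2 + nu) = s ^ 2)
    (hr : (X1 - tau) * (phi1 - nu) * (phi2 + nu) / (X2 + tau) = r ^ 2)
    (hs0 : 0 ≤ s) (hr0 : 0 ≤ r) (hs1 : s < 1) (hsx : 1 - s ≤ X2 + tau) :
    payoffs phi1 phi2 X1 X2 tau nu =
      (1 / 2 * r, (phi2 + nu) * (1 - 1 / (2 * (X2 + tau))) + 1 / 2 * r) := by
  rw [payoffs, if_pos hlt.le, basePayoff, if_neg (fun h => hlt.ne h.1), if_neg hcase.not_ge,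
    hs, hr, Real.sqrt_sq hs0, Real.sqrt_sq hr0, if_pos ⟨sub_pos.2 hs1, hsx⟩]

theorem mutuallyBeneficial_budget_transfer :
    MutuallyBeneficial 1 1 (2 / 101) (200 / 101) (2 / 101 - 1 / 13) 0 := by
  have h₀ : payoffs 1 1 (2 / 101) (200 / 101) 0 0 = _ :=
    payoffs_eq_of_sq (20 / 101) (1 / 10) (by norm_num) (by norm_num) (by norm_num) (by norm_num)
      (by norm_num) (by norm_num) (by norm_num) (by norm_num)
  have h₁ : payoffs 1 1 (2 / 101) (200 / 101) (2 / 101 - 1 / 13) 0 = _ :=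
    payoffs_eq_of_sq (5 / 13) (1 / 5) (by norm_num) (by norm_num) (by norm_num) (by norm_num)
      (by norm_num) (by norm_num) (by norm_num) (by norm_num)
  simp only [MutuallyBeneficial, U1, U2, h₀, h₁, Set.mem_Ioo]
  norm_num

theorem mutuallyBeneficial_contest_transfer :
    MutuallyBeneficial 9 1 (1 / 100) 1 0 4 := by
  have h₀ : payoffs 9 1 (1 / 100) 1 0 0 = _ :=
    payoffs_eq_of_sq (3 / 10) (3 / 10) (by norm_num) (by norm_num) (by norm_num) (by norm_num)
      (by norm_num) (by norm_num) (by norm_num) (by norm_num)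
  have h₁ : payoffs 9 1 (1 / 100) 1 0 4 = _ :=
    payoffs_eq_of_sq (1 / 10) (1 / 2) (by norm_num) (by norm_num) (by norm_num) (by norm_num)
      (by norm_num) (by norm_num) (by norm_num) (by norm_num)
  simp only [MutuallyBeneficial, U1, U2, h₀, h₁, Set.mem_Ioo]
  norm_num

/-- **Theorem 1(a).** Each of `𝐆^τ`, `𝐆^ν`, and `𝐆^{τ,ν}` is nonempty. -/
theorem mutually_beneficial_sets_nonempty :
    GTau.Nonempty ∧ GNu.Nonempty ∧ GTauNu.Nonempty := by
  have hτ : ((1, 1, 2 / 101, 200 / 101) : ℝ × ℝ × ℝ × ℝ) ∈ Games := by norm_num [Games]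
  have hν : ((9, 1, 1 / 100, 1) : ℝ × ℝ × ℝ × ℝ) ∈ Games := by norm_num [Games]
  exact ⟨⟨_, hτ, _, mutuallyBeneficial_budget_transfer⟩,
    ⟨_, hν, _, mutuallyBeneficial_contest_transfer⟩,
    ⟨_, hτ, _, _, mutuallyBeneficial_budget_transfer⟩⟩
end

section
/- The Coalitional General Lotto game G = (12, 10, 0.4, 1.6) belongs to both 𝐆^τ and 𝐆^ν; that is, for this game there exists a mutually beneficial budget transfer (τ, 0) and there exists a mutually beneficial contest transfer (0, ν). In particular, 𝐆^τ ∩ 𝐆^ν is nonempty. -/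
open Real Set

theorem payoffs_base :
    payoffs 12 10 0.4 1.6 0 0 = ((1 / 2) * Real.sqrt 30, 6.875 + (1 / 2) * Real.sqrt 30) := by
  have h0 : 0 < Real.sqrt (0.768 : ℝ) := Real.sqrt_pos.2 (by norm_num)
  have h1 : Real.sqrt (0.768 : ℝ) < 1 := (Real.sqrt_lt' one_pos).2 (by norm_num)
  have e1 : ((0.4 : ℝ) - 0) * (1.6 + 0) * (12 - 0) / (10 + 0) = 0.768 := by norm_num
  have e2 : ((0.4 : ℝ) - 0) * (12 - 0) * (10 + 0) / (1.6 + 0) = 30 := by norm_num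
  unfold payoffs basePayoff
  rw [if_pos (by norm_num), if_neg (by norm_num), if_neg (by norm_num), e1, e2,
    if_pos ⟨by linarith, by linarith⟩]
  norm_num

theorem payoffs_budget_transfer : payoffs 12 10 0.4 1.6 (-0.2) 0 = (3.6, 10) := by
  unfold payoffs basePayoff
  rw [if_pos (by norm_num), if_neg (by norm_num), if_pos (by norm_num), if_pos (by norm_num)]
  norm_num

theorem payoffs_contest_transfer : payoffs 12 10 0.4 1.6 0 1 = (2.75, 10.3125) := by
  have h0 : Real.sqrt (0.64 : ℝ) = 0.8 := by
    rw [show (0.64 : ℝ) = 0.8 ^ 2 by norm_num]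
    exact Real.sqrt_sq (by norm_num)
  have h1 : Real.sqrt (30.25 : ℝ) = 5.5 := by
    rw [show (30.25 : ℝ) = 5.5 ^ 2 by norm_num]
    exact Real.sqrt_sq (by norm_num)
  have e1 : ((0.4 : ℝ) - 0) * (1.6 + 0) * (12 - 1) / (10 + 1) = 0.64 := by norm_num
  have e2 : ((0.4 : ℝ) - 0) * (12 - 1) * (10 + 1) / (1.6 + 0) = 30.25 := by norm_num
  unfold payoffs basePayoff
  rw [if_pos (by norm_num), if_neg (by norm_num), if_neg (by norm_num), e1, e2, h0, h1,
    if_pos (by norm_num)]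
  norm_num

/-- **Theorem 1(b).** The game `G = (12, 10, 0.4, 1.6)` admits both a mutually
beneficial budget transfer and a mutually beneficial contest transfer; in
particular `𝐆^τ ∩ 𝐆^ν` is nonempty. -/
theorem example_game_in_GTau_inter_GNu :
    ((12, 10, 0.4, 1.6) : ℝ × ℝ × ℝ × ℝ) ∈ GTau ∩ GNu ∧
    (GTau ∩ GNu).Nonempty := by
  have h30 : Real.sqrt (30 : ℝ) < 5.5 := (Real.sqrt_lt' (by norm_num)).2 (by norm_num)
  have hG : ((12, 10, 0.4, 1.6) : ℝ × ℝ × ℝ × ℝ) ∈ Games := by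
    norm_num [Games]
  have hmem : ((12, 10, 0.4, 1.6) : ℝ × ℝ × ℝ × ℝ) ∈ GTau ∩ GNu := by
    refine ⟨⟨hG, -0.2, ?_⟩, hG, 1, ?_⟩
    · refine ⟨by norm_num, by norm_num, ?_, ?_⟩ <;>
        simp only [U1, U2, payoffs_base, payoffs_budget_transfer] <;> linarith
    · refine ⟨by norm_num, by norm_num, ?_, ?_⟩ <;>
        simp only [U1, U2, payoffs_base, payoffs_contest_transfer] <;> linarith
  exact ⟨hmem, _, hmem⟩
end

section
/- Each of the three set differences 𝐆^τ \ 𝐆^ν, 𝐆^ν \ 𝐆^τ, and 𝐆^{τ,ν} \ (𝐆^τ ∪ 𝐆^ν) is nonempty; that is, there is a game admitting a mutually beneficial budget transfer but no mutually beneficial contest transfer, a game admitting a mutually beneficial contest transfer but no mutually beneficial budget transfer, and a game admitting a mutually beneficial joint transfer but neither a mutually beneficial budget transfer nor a mutually beneficial contest transfer alone. -/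
open Real Set

/-- The weaker player's payoff is at most the value of its contests. -/
lemma basePayoff_fst_le {S p1 p2 x1 x2 : ℝ} (hS : 0 < S) (hp1 : 0 < p1) (hp2 : 0 < p2)
    (hx1 : 0 < x1) (hx2 : 0 < x2) (hord : x1 * p2 ≤ x2 * p1) :
    (basePayoff S p1 p2 x1 x2).1 ≤ p1 := by
  unfold basePayoff
  split_ifs with h4 h1 hlt h2
  · have : 0 < 1 / (2 * S) := by positivity
    nlinarith
  · dsimp only
    nlinarith
  · have : 0 < 1 / (2 * x1) := by positivity
    dsimp only
    nlinarith
  · have : √(x1 * p1 * p2 / x2) ≤ p1 := by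
      rw [Real.sqrt_le_left hp1.le, div_le_iff₀ hx2]
      nlinarith
    dsimp only
    linarith
  · have hge : x1 ≤ √(x1 * x2 * p1 / p2) := by
      apply Real.le_sqrt_of_sq_le
      rw [le_div_iff₀ hp2]
      nlinarith
    have hlt : √(x1 * x2 * p1 / p2) < 1 := by
      rw [Real.sqrt_lt' one_pos, div_lt_iff₀ hp2]
      linarith
    have hsum : x1 + x2 < 1 := by
      by_contra! hc
      exact h2 ⟨by linarith, by linarith⟩
    have : √(x1 * x2 * p1 * p2) ≤ x2 * p1 := by
      rw [Real.sqrt_le_left (by positivity)]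
      nlinarith [mul_le_mul_of_nonneg_left hord (mul_pos hx2 hp1).le]
    dsimp only
    nlinarith

/-- The stronger player's payoff is at most the value of its contests. -/
lemma basePayoff_snd_le {S p1 p2 x1 x2 : ℝ} (hS : 0 < S) (hp2 : 0 < p2) (hx2 : 0 < x2) :
    (basePayoff S p1 p2 x1 x2).2 ≤ p2 := by
  unfold basePayoff
  split_ifs with h4 h1 hlt h2
  · have : 0 < 1 / (2 * S) := by positivity
    nlinarith
  · exact le_rfl
  · exact le_rfl
  · have : √(x1 * p1 * p2 / x2) ≤ p2 / x2 := by
      rw [Real.sqrt_le_left (by positivity), div_pow, div_le_div_iff₀ hx2 (by positivity)]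
      nlinarith [mul_le_mul_of_nonneg_left (not_le.1 h1).le (mul_pos hp2 hx2).le]
    have heq : p2 * (1 - 1 / (2 * x2)) = p2 - p2 / x2 / 2 := by
      field_simp
    dsimp only
    linarith
  · have hlt : √(x1 * x2 * p1 / p2) < 1 := by
      rw [Real.sqrt_lt' one_pos, div_lt_iff₀ hp2]
      linarith
    have hsum : x2 < 1 := by
      by_contra! hc
      exact h2 ⟨by linarith, by linarith [Real.sqrt_nonneg (x1 * x2 * p1 / p2)]⟩
    have : √(x1 * x2 * p1 * p2) ≤ p2 := by
      rw [Real.sqrt_le_left hp2.le]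
      nlinarith
    dsimp only
    nlinarith

/-- Closed form of the payoffs when the adversary contests both fronts and the stronger
player's budget is at least the adversary's. -/
lemma basePayoff_of_one_le {S p1 p2 x1 x2 : ℝ} (hp2 : 0 < p2) (hx2 : 1 ≤ x2)
    (hord : x1 * p2 < x2 * p1) (hlt : x1 * x2 * p1 < p2) :
    basePayoff S p1 p2 x1 x2 = ((1 / 2) * √(x1 * p1 * p2 / x2),
      p2 * (1 - 1 / (2 * x2)) + (1 / 2) * √(x1 * p1 * p2 / x2)) := by
  have h : √(x1 * x2 * p1 / p2) < 1 := by
    rw [Real.sqrt_lt' one_pos, div_lt_iff₀ hp2]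
    linarith
  unfold basePayoff
  rw [if_neg (fun h4 => hord.ne h4.1), if_neg hlt.not_ge,
    if_pos ⟨by linarith, by linarith [Real.sqrt_nonneg (x1 * x2 * p1 / p2)]⟩]

/-- The payoffs when the adversary concentrates on the weaker player. -/
lemma basePayoff_of_le {S p1 p2 x1 x2 : ℝ} (hx1 : x1 < 1)
    (hord : x1 * p2 < x2 * p1) (hle : p2 ≤ x1 * x2 * p1) :
    basePayoff S p1 p2 x1 x2 = (p1 * x1 / 2, p2) := by
  unfold basePayoff
  rw [if_neg (fun h4 => hord.ne h4.1), if_pos hle, if_pos hx1]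

lemma payoffs_of_le {phi1 phi2 X1 X2 tau nu : ℝ}
    (h : (X1 - tau) * (phi2 + nu) ≤ (X2 + tau) * (phi1 - nu)) :
    payoffs phi1 phi2 X1 X2 tau nu =
      basePayoff (X1 + X2) (phi1 - nu) (phi2 + nu) (X1 - tau) (X2 + tau) :=
  if_pos h

lemma U1_le {phi1 phi2 X1 X2 tau nu : ℝ} (ht : tau ∈ Ioo (-X2) X1)
    (hn : nu ∈ Ioo (-phi2) phi1) : U1 phi1 phi2 X1 X2 tau nu ≤ phi1 - nu := by
  obtain ⟨ht1, ht2⟩ := ht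
  obtain ⟨hn1, hn2⟩ := hn
  unfold U1 payoffs
  split_ifs with h
  · exact basePayoff_fst_le (by linarith) (by linarith) (by linarith) (by linarith)
      (by linarith) h
  · exact basePayoff_snd_le (by linarith) (by linarith) (by linarith)

lemma U2_le {phi1 phi2 X1 X2 tau nu : ℝ} (ht : tau ∈ Ioo (-X2) X1)
    (hn : nu ∈ Ioo (-phi2) phi1) : U2 phi1 phi2 X1 X2 tau nu ≤ phi2 + nu := by
  obtain ⟨ht1, ht2⟩ := ht
  obtain ⟨hn1, hn2⟩ := hn
  unfold U2 payoffs
  split_ifs with h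
  · exact basePayoff_snd_le (by linarith) (by linarith) (by linarith)
  · exact basePayoff_fst_le (by linarith) (by linarith) (by linarith) (by linarith)
      (by linarith) (not_le.1 h).le

lemma payoffs_of_one_le {phi1 phi2 X1 X2 tau nu : ℝ} (hp2 : 0 < phi2 + nu)
    (hx2 : 1 ≤ X2 + tau) (hord : (X1 - tau) * (phi2 + nu) < (X2 + tau) * (phi1 - nu))
    (hlt : (X1 - tau) * (X2 + tau) * (phi1 - nu) < phi2 + nu) :
    payoffs phi1 phi2 X1 X2 tau nu =
      ((1 / 2) * √((X1 - tau) * (phi1 - nu) * (phi2 + nu) / (X2 + tau)),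
      (phi2 + nu) * (1 - 1 / (2 * (X2 + tau))) +
        (1 / 2) * √((X1 - tau) * (phi1 - nu) * (phi2 + nu) / (X2 + tau))) := by
  rw [payoffs_of_le hord.le, basePayoff_of_one_le hp2 hx2 hord hlt]

lemma payoffs_of_concentrated {phi1 phi2 X1 X2 tau nu : ℝ} (hx1 : X1 - tau < 1)
    (hord : (X1 - tau) * (phi2 + nu) < (X2 + tau) * (phi1 - nu))
    (hle : phi2 + nu ≤ (X1 - tau) * (X2 + tau) * (phi1 - nu)) :
    payoffs phi1 phi2 X1 X2 tau nu = ((phi1 - nu) * (X1 - tau) / 2, phi2 + nu) := by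
  rw [payoffs_of_le hord.le, basePayoff_of_le hx1 hord hle]

/-- No budget transfer helps a player whose payoff already equals its total valuation. -/
lemma notMem_GTau_of_U2_eq {phi1 phi2 X1 X2 : ℝ} (h : U2 phi1 phi2 X1 X2 0 0 = phi2) :
    (phi1, phi2, X1, X2) ∉ GTau := by
  rintro ⟨-, tau, ht, hn, -, h2⟩
  have := U2_le ht hn
  dsimp only at *
  linarith

lemma GTau_diff_GNu_nonempty : (GTau \ GNu).Nonempty := by
  have hs : √(1 / 16 : ℝ) = 1 / 4 := by
    rw [show (1 / 16 : ℝ) = (1 / 4) ^ 2 by norm_num, Real.sqrt_sq (by norm_num)]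
  have h0 : payoffs 1 1 (1 / 8) 2 0 0 = (1 / 8, 7 / 8) := by
    rw [payoffs_of_one_le (by norm_num) (by norm_num) (by norm_num) (by norm_num)]
    norm_num [hs]
  refine ⟨(1, 1, 1 / 8, 2), ⟨by norm_num [Games], -1 / 2, by norm_num, by norm_num, ?_⟩, ?_⟩
  · have hb : (3 / 5 : ℝ) ≤ √(5 / 12) := Real.le_sqrt_of_sq_le (by norm_num)
    have h1 : payoffs 1 1 (1 / 8) 2 (-1 / 2) 0 =
        (1 / 2 * √(5 / 12), 2 / 3 + 1 / 2 * √(5 / 12)) := by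
      rw [payoffs_of_one_le (by norm_num) (by norm_num) (by norm_num) (by norm_num)]
      norm_num
    simp only [U1, U2, h0, h1]
    constructor <;> linarith
  · rintro ⟨-, nu, ht, hn, h1, h2⟩
    have hc1 := U1_le ht hn
    have hc2 := U2_le ht hn
    obtain ⟨hn1, hn2⟩ := hn
    simp only [U1, U2, h0] at h1 h2 hc1 hc2 hn1 hn2
    rw [payoffs_of_one_le (by linarith) (by norm_num) (by linarith) (by linarith)] at h1
    have : √((1 / 8 - 0) * (1 - nu) * (1 + nu) / (2 + 0)) ≤ 1 / 4 := by
      rw [Real.sqrt_le_left (by norm_num)]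
      nlinarith [sq_nonneg nu]
    dsimp only at h1
    linarith

lemma GNu_diff_GTau_nonempty : (GNu \ GTau).Nonempty := by
  have h0 : payoffs 1 (1 / 2) (1 / 2) 1 0 0 = (1 / 4, 1 / 2) := by
    rw [payoffs_of_concentrated (by norm_num) (by norm_num) (by norm_num)]
    norm_num
  refine ⟨(1, 1 / 2, 1 / 2, 1), ⟨by norm_num [Games], 1 / 4, by norm_num, by norm_num, ?_⟩,
    notMem_GTau_of_U2_eq (by simp only [U2, h0])⟩
  have hb : (21 / 40 : ℝ) ≤ √(9 / 32) := Real.le_sqrt_of_sq_le (by norm_num)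
  have h1 : payoffs 1 (1 / 2) (1 / 2) 1 0 (1 / 4) =
      (1 / 2 * √(9 / 32), 3 / 8 + 1 / 2 * √(9 / 32)) := by
    rw [payoffs_of_one_le (by norm_num) (by norm_num) (by norm_num) (by norm_num)]
    norm_num
  simp only [U1, U2, h0, h1]
  constructor <;> linarith

lemma GTauNu_diff_union_nonempty : (GTauNu \ (GTau ∪ GNu)).Nonempty := by
  have h0 : payoffs 1 1 (1 / 4) 4 0 0 = (1 / 8, 1) := by
    rw [payoffs_of_concentrated (by norm_num) (by norm_num) (by norm_num)]
    norm_num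
  refine ⟨(1, 1, 1 / 4, 4),
    ⟨by norm_num [Games], -1 / 4, 1 / 2, by norm_num, by norm_num, ?_⟩, ?_⟩
  · have hb : (3 / 10 : ℝ) ≤ √(1 / 10) := Real.le_sqrt_of_sq_le (by norm_num)
    have h1 : payoffs 1 1 (1 / 4) 4 (-1 / 4) (1 / 2) =
        (1 / 2 * √(1 / 10), 13 / 10 + 1 / 2 * √(1 / 10)) := by
      rw [payoffs_of_one_le (by norm_num) (by norm_num) (by norm_num) (by norm_num)]
      norm_num
    simp only [U1, U2, h0, h1]
    constructor <;> linarith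
  · rintro (h | ⟨-, nu, ht, hn, h1, h2⟩)
    · exact notMem_GTau_of_U2_eq (by simp only [U2, h0]) h
    have hc1 := U1_le ht hn
    have hc2 := U2_le ht hn
    obtain ⟨hn1, hn2⟩ := hn
    simp only [U1, U2, h0] at h1 h2 hc1 hc2 hn1 hn2
    rw [payoffs_of_one_le (by linarith) (by norm_num) (by linarith) (by linarith)] at h1
    have : √((1 / 4 - 0) * (1 - nu) * (1 + nu) / (4 + 0)) ≤ 1 / 4 := by
      rw [Real.sqrt_le_left (by norm_num)]
      nlinarith [sq_nonneg nu]
    dsimp only at h1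
    linarith

/-- **Theorem 1(c).** The set differences `𝐆^τ \ 𝐆^ν`, `𝐆^ν \ 𝐆^τ`, and
`𝐆^{τ,ν} \ (𝐆^τ ∪ 𝐆^ν)` are all nonempty. -/
theorem mutually_beneficial_set_differences_nonempty :
    (GTau \ GNu).Nonempty ∧ (GNu \ GTau).Nonempty ∧
    (GTauNu \ (GTau ∪ GNu)).Nonempty := by
  exact ⟨GTau_diff_GNu_nonempty, GNu_diff_GTau_nonempty, GTauNu_diff_union_nonempty⟩
end

section
/- The complement 𝐆 \ 𝐆^{τ,ν} of the set of games admitting a mutually beneficial joint transfer, viewed as a subset of ℝ⁴₍₊₎ ⊆ ℝ⁴, has four-dimensional Lebesgue measure zero; that is, almost every Coalitional General Lotto game admits a mutually beneficial joint transfer. -/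
open Real Set

/-- The collective payoff of two players with total contest value `P` and total budget `S`
whose budget-to-valuation ratios coincide. -/
noncomputable def balancedTotal (P S : ℝ) : ℝ :=
  if 1 ≤ S then P * (1 - 1 / (2 * S)) else P * S / 2

theorem basePayoff_balanced {P S l : ℝ} (hP : 0 < P) (hS : 0 < S) (hl0 : 0 < l) (hl1 : l < 1) :
    basePayoff S (l * P) ((1 - l) * P) (l * S) ((1 - l) * S)
      = (l * balancedTotal P S, (1 - l) * balancedTotal P S) := by
  have hm : 0 < 1 - l := by linarith
  have he : l * S * ((1 - l) * P) = (1 - l) * S * (l * P) := by ring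
  unfold basePayoff balancedTotal
  by_cases h : 1 ≤ S
  · rw [if_pos ⟨he, h⟩, if_pos h]
    ext <;> simp only <;> ring
  · rw [if_neg (fun H => h H.2), if_neg h]
    have hlS : l * S < 1 := by nlinarith
    have hs : √(l * S * ((1 - l) * S) * (l * P) / ((1 - l) * P)) = l * S := by
      rw [show l * S * ((1 - l) * S) * (l * P) / ((1 - l) * P) = (l * S) ^ 2 by
        field_simp]
      exact Real.sqrt_sq (by positivity)
    have ht : √(l * S * ((1 - l) * S) * (l * P) * ((1 - l) * P)) = l * S * ((1 - l) * P) := by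
      rw [show l * S * ((1 - l) * S) * (l * P) * ((1 - l) * P) = (l * S * ((1 - l) * P)) ^ 2 by
        ring]
      exact Real.sqrt_sq (by positivity)
    have hc1 : ¬ (1 - l) * P ≤ l * S * ((1 - l) * S) * (l * P) := by
      have h1 : (l * S) ^ 2 < 1 := by
        have : 0 < l * S := by positivity
        nlinarith
      have h2 : 0 < (1 - l) * P := by positivity
      rw [show l * S * ((1 - l) * S) * (l * P) = (l * S) ^ 2 * ((1 - l) * P) by ring]
      nlinarith
    rw [if_neg hc1, hs, ht, if_neg (by rintro ⟨-, H⟩; apply h; linarith)]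
    ext <;> simp only <;> ring

/-- When the budget-to-valuation ratios differ, the collective payoff falls short of the
balanced one. -/
theorem basePayoff_lt_balancedTotal {p q a b : ℝ} (hp : 0 < p) (hq : 0 < q) (ha : 0 < a)
    (hb : 0 < b) (h : a * q < b * p) :
    0 ≤ (basePayoff (a + b) p q a b).1 ∧ 0 ≤ (basePayoff (a + b) p q a b).2 ∧
      (basePayoff (a + b) p q a b).1 + (basePayoff (a + b) p q a b).2
        < balancedTotal (p + q) (a + b) := by
  have hS : 0 < a + b := by positivity
  unfold basePayoff balancedTotal
  rw [if_neg (fun H => h.ne H.1)]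
  by_cases h1 : q ≤ a * b * p
  · rw [if_pos h1]
    by_cases ha1 : a < 1
    · simp only [if_pos ha1]
      refine ⟨by positivity, hq.le, ?_⟩
      split_ifs with hS1
      · rw [show (p + q) * (1 - 1 / (2 * (a + b)))
            = (p + q) * (2 * (a + b) - 1) / (2 * (a + b)) by field_simp,
          lt_div_iff₀ (by positivity)]
        have h2 : 0 < (1 - a) * (2 * b - (1 - a)) :=
          mul_pos (by linarith) (by linarith)
        nlinarith [mul_pos hp h2]
      · have h2 : 0 < p * b * ((1 - a) ^ 2 + a * b) := by positivity
        nlinarith [mul_nonneg (sub_nonneg.2 h1) (show 0 ≤ 2 - (a + b) by linarith)]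
    · simp only [if_neg ha1]
      push Not at ha1
      rw [if_pos (by linarith)]
      refine ⟨mul_nonneg hp.le ?_, hq.le, ?_⟩
      · rw [sub_nonneg, div_le_one (by positivity)]; linarith
      · have h2 : (p + q) / (2 * (a + b)) < p / (2 * a) := by
          rw [div_lt_div_iff₀ (by positivity) (by positivity)]; nlinarith
        have e1 : (p + q) * (1 - 1 / (2 * (a + b))) = p + q - (p + q) / (2 * (a + b)) := by ring
        have e2 : p * (1 - 1 / (2 * a)) = p - p / (2 * a) := by ring
        linarith
  · rw [if_neg h1]
    push Not at h1
    obtain ⟨s, hsdef⟩ : ∃ s, s = √(a * b * p / q) := ⟨_, rfl⟩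
    have hs0 : 0 ≤ s := hsdef ▸ Real.sqrt_nonneg _
    have hs2 : q * s ^ 2 = a * b * p := by
      rw [hsdef, Real.sq_sqrt (by positivity)]; field_simp
    have has : a < s := by
      refine lt_of_pow_lt_pow_left₀ 2 hs0 ?_
      have : q * a ^ 2 < q * s ^ 2 := by rw [hs2]; nlinarith
      exact lt_of_mul_lt_mul_left this hq.le
    have hps : p = q * s ^ 2 / (a * b) := by rw [hs2]; field_simp
    have ht : √(a * p * q / b) = q * s / b := by
      rw [show a * p * q / b = (q * s / b) ^ 2 by
        rw [div_pow, mul_pow, pow_two q, mul_assoc q q, hs2]; field_simp]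
      exact Real.sqrt_sq (by positivity)
    have hu : √(a * b * p * q) = q * s := by
      rw [← hs2, show q * s ^ 2 * q = (q * s) ^ 2 by ring]
      exact Real.sqrt_sq (by positivity)
    rw [← hsdef, ht, hu]
    by_cases h2 : 0 < 1 - s ∧ 1 - s ≤ b
    · rw [if_pos h2]
      simp only
      refine ⟨by positivity, ?_, ?_⟩
      · rw [show q * (1 - 1 / (2 * b)) + 1 / 2 * (q * s / b) = q * (2 * b - 1 + s) / (2 * b) by
          field_simp]
        have : 0 ≤ 2 * b - 1 + s := by linarith [h2.2]
        positivity
      · have e : 1 / 2 * (q * s / b) + (q * (1 - 1 / (2 * b)) + 1 / 2 * (q * s / b))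
            = q * (2 * b - 1 + 2 * s) / (2 * b) := by field_simp; ring
        rw [e]
        have e' : p + q = q * (a * b + s ^ 2) / (a * b) := by
          rw [hps]; field_simp; ring
        rw [e']
        split_ifs with hS1
        · rw [show q * (a * b + s ^ 2) / (a * b) * (1 - 1 / (2 * (a + b)))
              = q * ((a * b + s ^ 2) * (2 * (a + b) - 1)) / (2 * (a * b * (a + b))) by
              field_simp,
            div_lt_div_iff₀ (by positivity) (by positivity)]
          have h3 : 0 < (s - a) * ((2 * (a + b) - 1) * (s + a) - 2 * a * (a + b)) := by
            refine mul_pos (by linarith) ?_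
            nlinarith [mul_pos (show 0 < 2 * (a + b) - 1 by linarith) (sub_pos.2 has)]
          have h4 := mul_pos (mul_pos hq hb) h3
          nlinarith
        · rw [div_mul_eq_mul_div, div_div, div_lt_div_iff₀ (by positivity) (by positivity)]
          push Not at hS1
          have h3 : 0 < (a + b) * ((a * b + s ^ 2) * (a + b) - a * (2 * b - 1 + 2 * s)) := by
            have : 0 < a * b * (1 - (a + b)) ^ 2 :=
              mul_pos (mul_pos ha hb) (pow_pos (by linarith) 2)
            nlinarith [sq_nonneg ((a + b) * s - a)]
          have h4 := mul_pos (mul_pos hq hb) (pos_of_mul_pos_right h3 hS.le)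
          nlinarith
    · rw [if_neg h2]
      simp only
      refine ⟨by positivity, by positivity, ?_⟩
      have hs1 : s < 1 := by
        have : q * s ^ 2 < q * 1 ^ 2 := by linarith
        exact lt_of_pow_lt_pow_left₀ 2 zero_le_one (lt_of_mul_lt_mul_left this hq.le)
      have hS1 : ¬ 1 ≤ a + b := fun H => h2 ⟨by linarith, by linarith⟩
      rw [if_neg hS1]
      have h3 : 2 * (q * s) < a * q + b * p := by
        have : 0 < q * (s - a) ^ 2 := mul_pos hq (pow_pos (by linarith) 2)
        have h4 : a * (2 * (q * s)) < a * (a * q + b * p) := by nlinarith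
        exact lt_of_mul_lt_mul_left h4 ha.le
      nlinarith

theorem payoffs_balanced {p q a b l : ℝ} (hP : 0 < p + q) (hS : 0 < a + b) (hl0 : 0 < l)
    (hl1 : l < 1) :
    payoffs p q a b (a - l * (a + b)) (p - l * (p + q))
      = (l * balancedTotal (p + q) (a + b), (1 - l) * balancedTotal (p + q) (a + b)) := by
  unfold payoffs
  rw [show a - (a - l * (a + b)) = l * (a + b) by ring,
    show b + (a - l * (a + b)) = (1 - l) * (a + b) by ring,
    show p - (p - l * (p + q)) = l * (p + q) by ring,
    show q + (p - l * (p + q)) = (1 - l) * (p + q) by ring,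
    if_pos (le_of_eq (by ring))]
  exact basePayoff_balanced hP hS hl0 hl1

theorem payoffs_lt_balancedTotal {p q a b : ℝ} (hp : 0 < p) (hq : 0 < q) (ha : 0 < a)
    (hb : 0 < b) (h : a * q ≠ b * p) :
    0 ≤ (payoffs p q a b 0 0).1 ∧ 0 ≤ (payoffs p q a b 0 0).2 ∧
      (payoffs p q a b 0 0).1 + (payoffs p q a b 0 0).2 < balancedTotal (p + q) (a + b) := by
  unfold payoffs
  simp only [sub_zero, add_zero]
  rcases lt_or_gt_of_ne h with h | h
  · rw [if_pos h.le]
    exact basePayoff_lt_balancedTotal hp hq ha hb h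
  · rw [if_neg h.not_ge]
    obtain ⟨h1, h2, h3⟩ := basePayoff_lt_balancedTotal hq hp hb ha h
    rw [add_comm b a, add_comm q p] at h3
    rw [add_comm b a] at h1 h2
    exact ⟨h2, h1, by rw [Prod.fst_swap, Prod.snd_swap]; linarith⟩

theorem exists_mutuallyBeneficial {p q a b : ℝ} (hp : 0 < p) (hq : 0 < q) (ha : 0 < a)
    (hb : 0 < b) (h : a * q ≠ b * p) : ∃ tau nu, MutuallyBeneficial p q a b tau nu := by
  obtain ⟨h1, h2, h3⟩ := payoffs_lt_balancedTotal hp hq ha hb h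
  have hS : 0 < a + b := by positivity
  have hP : 0 < p + q := by positivity
  set M := balancedTotal (p + q) (a + b) with hM
  have hM0 : 0 < M := by linarith
  obtain ⟨v, hv1, hv2⟩ := exists_between (lt_sub_iff_add_lt.2 h3)
  have hl0 : 0 < v / M := div_pos (by linarith) hM0
  have hl1 : v / M < 1 := (div_lt_one hM0).2 (by linarith)
  have hv : v / M * M = v := div_mul_cancel₀ v hM0.ne'
  refine ⟨a - v / M * (a + b), p - v / M * (p + q), ⟨?_, ?_⟩, ⟨?_, ?_⟩, ?_, ?_⟩
  · nlinarith
  · nlinarith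
  · nlinarith
  · nlinarith
  · unfold U1
    rw [payoffs_balanced hP hS hl0 hl1, ← hM, hv]
    exact hv1
  · unfold U2
    rw [payoffs_balanced hP hS hl0 hl1, ← hM, sub_mul, hv]
    simp only
    linarith

theorem volume_equal_ratio_eq_zero :
    MeasureTheory.volume {g : ℝ × ℝ × ℝ × ℝ | 0 < g.2.2.2 ∧ g.2.2.1 * g.2.1 = g.2.2.2 * g.1}
      = 0 := by
  have hmeas : MeasurableSet
      {g : ℝ × ℝ × ℝ × ℝ | 0 < g.2.2.2 ∧ g.2.2.1 * g.2.1 = g.2.2.2 * g.1} :=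
    MeasurableSet.inter (s₁ := {g : ℝ × ℝ × ℝ × ℝ | 0 < g.2.2.2})
      (s₂ := {g : ℝ × ℝ × ℝ × ℝ | g.2.2.1 * g.2.1 = g.2.2.2 * g.1})
      (measurableSet_lt (by fun_prop) (by fun_prop))
      (measurableSet_eq_fun (by fun_prop) (by fun_prop))
  rw [MeasureTheory.Measure.volume_eq_prod, MeasureTheory.Measure.prod_apply_symm hmeas]
  refine (MeasureTheory.lintegral_congr fun y => ?_).trans MeasureTheory.lintegral_zero
  refine MeasureTheory.measure_mono_null (t := {y.2.1 * y.1 / y.2.2}) ?_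
    (MeasureTheory.measure_singleton _)
  rintro x ⟨hy, hx⟩
  simp only at hy hx
  rw [Set.mem_singleton_iff, hx]
  field_simp

/-- **Theorem 1(d).** `𝐆 \ 𝐆^{τ,ν}` has (four-dimensional Lebesgue) measure
zero: almost every game admits a mutually beneficial joint transfer. -/
theorem complement_GTauNu_measure_zero :
    MeasureTheory.volume (Games \ GTauNu) = 0 := by
  refine MeasureTheory.measure_mono_null ?_ volume_equal_ratio_eq_zero
  rintro g ⟨hg, hn⟩
  obtain ⟨h1, h2, h3, h4⟩ := hg
  refine ⟨h4, ?_⟩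
  by_contra h
  exact hn ⟨⟨h1, h2, h3, h4⟩, exists_mutuallyBeneficial h1 h2 h3 h4 h⟩
end

section
/- Assume φ₁ > φ₂. The derivative of Player 2's Case-2 payoff at ν = 0 is positive if and only if (2 − 4X₂)/(φ₁ − φ₂) < √(X₁X₂/(φ₁φ₂)); that is, g′(0) > 0 ⟺ (2 − 4X₂)/(φ₁ − φ₂) < √(X₁X₂/(φ₁φ₂)), where g(ν) = (φ₂+ν)(1 − 1/(2X₂)) + (1/2)√(X₁(φ₁−ν)(φ₂+ν)/X₂). -/
/-- Player 2's Case-2 payoff as a function of the contest transfer `ν`. -/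
noncomputable def case2Payoff2 (phi1 phi2 X1 X2 nu : ℝ) : ℝ :=
  (phi2 + nu) * (1 - 1 / (2 * X2)) +
    (1 / 2) * Real.sqrt (X1 * (phi1 - nu) * (phi2 + nu) / X2)

lemma sqrt_contest_mul_sqrt {p X1 X2 : ℝ} (hp : 0 < p) (hX1 : 0 < X1) (hX2 : 0 < X2) :
    Real.sqrt (X1 * p / X2) * Real.sqrt (X1 * X2 / p) = X1 := by
  rw [← Real.sqrt_mul (by positivity),
    show X1 * p / X2 * (X1 * X2 / p) = X1 ^ 2 by field_simp, Real.sqrt_sq hX1.le]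

lemma hasDerivAt_case2Payoff2_zero {phi1 phi2 X1 X2 : ℝ}
    (hphi1 : 0 < phi1) (hphi2 : 0 < phi2) (hX1 : 0 < X1) (hX2 : 0 < X2) :
    HasDerivAt (case2Payoff2 phi1 phi2 X1 X2)
      ((4 * X2 - 2 + (phi1 - phi2) * Real.sqrt (X1 * X2 / (phi1 * phi2))) / (4 * X2)) 0 := by
  have hlin : HasDerivAt (fun nu : ℝ => phi2 + nu) 1 0 := (hasDerivAt_id 0).const_add phi2
  have hrad : HasDerivAt (fun nu : ℝ => X1 * (phi1 - nu) * (phi2 + nu) / X2)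
      (X1 * (phi1 - phi2) / X2) 0 := by
    refine ((((hasDerivAt_id (0 : ℝ)).const_sub phi1).const_mul X1).mul hlin).div_const X2
      |>.congr_deriv ?_
    simp only [id]
    ring
  have hpos : 0 < X1 * (phi1 * phi2) / X2 := by positivity
  have hval : X1 * (phi1 - 0) * (phi2 + 0) / X2 = X1 * (phi1 * phi2) / X2 := by ring
  have hderiv := (hlin.mul_const (1 - 1 / (2 * X2))).add
    ((hrad.sqrt (by rw [hval]; exact hpos.ne')).const_mul (1 / 2))
  rw [hval] at hderiv
  refine hderiv.congr_deriv ?_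
  have hmul := sqrt_contest_mul_sqrt (mul_pos hphi1 hphi2) hX1 hX2
  have hR := Real.sqrt_pos.2 hpos
  generalize Real.sqrt (X1 * (phi1 * phi2) / X2) = R at hmul hR ⊢
  generalize Real.sqrt (X1 * X2 / (phi1 * phi2)) = S at hmul ⊢
  field_simp
  linear_combination (-4 * (phi1 - phi2)) * hmul

/-- Assuming `φ₁ > φ₂`, the derivative of Player 2's Case-2 payoff at `ν = 0` is
positive if and only if `(2 − 4X₂)/(φ₁ − φ₂) < √(X₁X₂/(φ₁φ₂))`. -/
theorem case2_deriv2_pos_iff (phi1 phi2 X1 X2 : ℝ)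
    (hphi1 : 0 < phi1) (hphi2 : 0 < phi2) (hX1 : 0 < X1) (hX2 : 0 < X2)
    (hphi : phi2 < phi1) :
    0 < deriv (case2Payoff2 phi1 phi2 X1 X2) 0 ↔
      (2 - 4 * X2) / (phi1 - phi2) < Real.sqrt (X1 * X2 / (phi1 * phi2)) := by
  rw [(hasDerivAt_case2Payoff2_zero hphi1 hphi2 hX1 hX2).deriv,
    div_pos_iff_of_pos_right (by positivity), div_lt_iff₀ (sub_pos.2 hphi)]
  constructor <;> intro h <;> linarith
end

section
/- The derivative of Player 1's Case-3 payoff at ν = 0 is positive if and only if φ₁ > φ₂ and X₂(φ₁ − φ₂)² > 4φ₁φ₂X₁; that is, h₁′(0) > 0 ⟺ (φ₁ > φ₂ and X₂ > (4φ₁φ₂/(φ₁−φ₂)²)·X₁), where h₁(ν) = (1/2)X₁(φ₁−ν) + (1/2)√(X₁X₂(φ₁−ν)(φ₂+ν)). -/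
/-- Player 1's Case-3 payoff as a function of the contest transfer `ν`. -/
noncomputable def case3Payoff1 (phi1 phi2 X1 X2 nu : ℝ) : ℝ :=
  (1 / 2) * X1 * (phi1 - nu) +
    (1 / 2) * Real.sqrt (X1 * X2 * (phi1 - nu) * (phi2 + nu))

theorem hasDerivAt_case3Payoff1 {phi1 phi2 X1 X2 nu : ℝ}
    (h : X1 * X2 * (phi1 - nu) * (phi2 + nu) ≠ 0) :
    HasDerivAt (case3Payoff1 phi1 phi2 X1 X2)
      (-(X1 / 2) + X1 * X2 * (phi1 - phi2 - 2 * nu) /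
        (4 * √(X1 * X2 * (phi1 - nu) * (phi2 + nu)))) nu := by
  have h1 : HasDerivAt (fun t : ℝ => phi1 - t) (-1) nu := (hasDerivAt_id nu).const_sub phi1
  have h2 : HasDerivAt (fun t : ℝ => phi2 + t) 1 nu := (hasDerivAt_id nu).const_add phi2
  have h3 := ((h1.const_mul (X1 * X2)).mul h2).sqrt h
  refine ((h1.const_mul (1 / 2 * X1)).add (h3.const_mul (1 / 2))).congr_deriv ?_
  simp only [Pi.mul_apply]
  ring

/-- The derivative of Player 1's Case-3 payoff at `ν = 0` is positive if and
only if `φ₁ > φ₂` and `X₂ > (4φ₁φ₂/(φ₁−φ₂)²)·X₁`. -/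
theorem case3_deriv1_pos_iff (phi1 phi2 X1 X2 : ℝ)
    (hphi1 : 0 < phi1) (hphi2 : 0 < phi2) (hX1 : 0 < X1) (hX2 : 0 < X2) :
    0 < deriv (case3Payoff1 phi1 phi2 X1 X2) 0 ↔
      (phi2 < phi1 ∧ 4 * phi1 * phi2 / (phi1 - phi2) ^ 2 * X1 < X2) := by
  have hP : 0 < X1 * X2 * phi1 * phi2 := by positivity
  have hd := hasDerivAt_case3Payoff1 (phi1 := phi1) (phi2 := phi2) (X1 := X1) (X2 := X2)
    (nu := 0) (by simpa using hP.ne')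
  simp only [sub_zero, add_zero, mul_zero] at hd
  rw [hd.deriv]
  have hs : 0 < √(X1 * X2 * phi1 * phi2) := Real.sqrt_pos.2 hP
  have hsq : √(X1 * X2 * phi1 * phi2) ^ 2 = X1 * X2 * phi1 * phi2 := Real.sq_sqrt hP.le
  set s := √(X1 * X2 * phi1 * phi2)
  have hform : -(X1 / 2) + X1 * X2 * (phi1 - phi2) / (4 * s) =
      X1 / (4 * s) * (X2 * (phi1 - phi2) - 2 * s) := by
    field_simp
    ring
  rw [hform, mul_pos_iff_of_pos_left (by positivity), sub_pos]
  have hsq_iff (hlt : phi2 < phi1) :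
      2 * s < X2 * (phi1 - phi2) ↔ 4 * phi1 * phi2 / (phi1 - phi2) ^ 2 * X1 < X2 := by
    have hdiff : 0 < phi1 - phi2 := sub_pos.2 hlt
    rw [div_mul_eq_mul_div, div_lt_iff₀ (by positivity),
      ← mul_lt_mul_iff_right₀ (b := 4 * phi1 * phi2 * X1) hX2,
      ← sq_lt_sq₀ (a := 2 * s) (by positivity) (by positivity), mul_pow 2 s, hsq]
    ring_nf
  constructor
  · intro h
    have hlt : phi2 < phi1 :=
      sub_pos.1 ((mul_pos_iff_of_pos_left hX2).1 (lt_trans (by positivity) h))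
    exact ⟨hlt, (hsq_iff hlt).1 h⟩
  · rintro ⟨hlt, h⟩
    exact (hsq_iff hlt).2 h
end

section
/- If φ₁ > φ₂ and X₂(φ₁ − φ₂)² > 4φ₁φ₂X₁, then there exists a positive contest transfer ν ∈ (0, φ₁) that strictly increases both Players' Case-3 payoffs: h₁(ν) > h₁(0) and h₂(ν) > h₂(0). -/
/-- Player 2's Case-3 payoff as a function of the contest transfer `ν`. -/
noncomputable def case3Payoff2 (phi1 phi2 X1 X2 nu : ℝ) : ℝ :=
  (1 / 2) * X2 * (phi2 + nu) +
    (1 / 2) * Real.sqrt (X1 * X2 * (phi1 - nu) * (phi2 + nu))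

/-- If `φ₁ > φ₂` and `X₂(φ₁ − φ₂)² > 4φ₁φ₂X₁`, then some positive contest
transfer `ν ∈ (0, φ₁)` strictly increases both Players' Case-3 payoffs. -/
theorem case3_mutually_beneficial_transfer_exists (phi1 phi2 X1 X2 : ℝ)
    (hphi1 : 0 < phi1) (hphi2 : 0 < phi2) (hX1 : 0 < X1) (hX2 : 0 < X2)
    (hphi : phi2 < phi1) (hcond : 4 * phi1 * phi2 * X1 < X2 * (phi1 - phi2) ^ 2) :
    ∃ nu ∈ Set.Ioo (0 : ℝ) phi1,
      case3Payoff1 phi1 phi2 X1 X2 nu > case3Payoff1 phi1 phi2 X1 X2 0 ∧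
      case3Payoff2 phi1 phi2 X1 X2 nu > case3Payoff2 phi1 phi2 X1 X2 0 := by
  set s := Real.sqrt (X1 * X2 * phi1 * phi2)
  have hs0 : 0 ≤ s := Real.sqrt_nonneg _
  have hs2 : s ^ 2 = X1 * X2 * phi1 * phi2 := Real.sq_sqrt (by positivity)
  have hd : 0 < X2 * (phi1 - phi2) - 2 * s := by
    have h : (2 * s) ^ 2 < (X2 * (phi1 - phi2)) ^ 2 := by
      linear_combination X2 * hcond + 4 * hs2
    have h' : 0 ≤ X2 * (phi1 - phi2) := mul_nonneg hX2.le (by linarith)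
    linarith [lt_of_pow_lt_pow_left₀ 2 h' h]
  obtain ⟨nu, hnu⟩ : ∃ nu, nu = (X2 * (phi1 - phi2) - 2 * s) / (2 * (X1 + X2)) := ⟨_, rfl⟩
  have hnu0 : 0 < nu := hnu ▸ by positivity
  have hnu1 : nu < phi1 := by
    rw [hnu, div_lt_iff₀ (by positivity)]
    nlinarith [mul_pos hX2 hphi1, mul_pos hX1 hphi1, mul_pos hX2 hphi2]
  have hlin : nu * (2 * (X1 + X2)) = X2 * (phi1 - phi2) - 2 * s := by
    rw [hnu]
    field_simp
  have hkey : s + X1 * nu < Real.sqrt (X1 * X2 * (phi1 - nu) * (phi2 + nu)) := by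
    apply Real.lt_sqrt_of_sq_lt
    have hpos : 0 < X1 * nu * (nu * (X1 + X2)) := by positivity
    linear_combination hpos + hs2 + X1 * nu * hlin
  have hzero : Real.sqrt (X1 * X2 * (phi1 - 0) * (phi2 + 0)) = s := by
    rw [sub_zero, add_zero]
  refine ⟨nu, ⟨hnu0, hnu1⟩, ?_, ?_⟩
  · unfold case3Payoff1
    rw [hzero]
    linarith
  · unfold case3Payoff2
    rw [hzero]
    linarith [mul_pos hX1 hnu0, mul_pos hX2 hnu0]
end

section
/- Let φ₁, φ₂ > 0 and X₁ ≥ 1, X₂ ≥ 1. There exists ν ∈ (−φ₂, φ₁) satisfying ν > (X₂φ₁ − X₁φ₂)/(X₁ + X₂), φ₁(1 − 1/(2X₁)) < φ₁ − ν, and φ₂ < (φ₂ + ν)(1 − 1/(2X₂)) if and only if (2X₁X₂ − X₁ − X₂)/(2X₁²) < φ₂/φ₁ < (2X₂ − 1)/(2X₁). -/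
/-- **Region 1 condition.** With `X₁ ≥ 1` and `X₂ ≥ 1`, a contest transfer `ν`
switching the Adversary's target from Player 1 to Player 2 and strictly
increasing both Players' payoffs exists iff
`(2X₁X₂ − X₁ − X₂)/(2X₁²) < φ₂/φ₁ < (2X₂ − 1)/(2X₁)`. -/
theorem region1_mutually_beneficial_iff (phi1 phi2 X1 X2 : ℝ)
    (hphi1 : 0 < phi1) (hphi2 : 0 < phi2) (hX1 : 1 ≤ X1) (hX2 : 1 ≤ X2) :
    (∃ nu ∈ Set.Ioo (-phi2) phi1,
      (X2 * phi1 - X1 * phi2) / (X1 + X2) < nu ∧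
      phi1 * (1 - 1 / (2 * X1)) < phi1 - nu ∧
      phi2 < (phi2 + nu) * (1 - 1 / (2 * X2))) ↔
    ((2 * X1 * X2 - X1 - X2) / (2 * X1 ^ 2) < phi2 / phi1 ∧
      phi2 / phi1 < (2 * X2 - 1) / (2 * X1)) := by
  have hX1' : 0 < X1 := by linarith
  have hX2' : 0 < X2 := by linarith
  have hD : 0 < 2 * X2 - 1 := by linarith
  have player1_gain (nu : ℝ) :
      phi1 * (1 - 1 / (2 * X1)) < phi1 - nu ↔ nu < phi1 / (2 * X1) := by
    have h : phi1 * (1 - 1 / (2 * X1)) = phi1 - phi1 / (2 * X1) := by ring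
    rw [h, sub_lt_sub_iff_left]
  have player2_gain (nu : ℝ) :
      phi2 < (phi2 + nu) * (1 - 1 / (2 * X2)) ↔ phi2 / (2 * X2 - 1) < nu := by
    have h : (phi2 + nu) * (1 - 1 / (2 * X2)) = (phi2 + nu) * (2 * X2 - 1) / (2 * X2) := by
      field_simp
    rw [h, lt_div_iff₀ (by positivity), div_lt_iff₀ hD]
    constructor <;> intro h <;> linarith
  have lower_bound : (2 * X1 * X2 - X1 - X2) / (2 * X1 ^ 2) < phi2 / phi1 ↔
      (X2 * phi1 - X1 * phi2) / (X1 + X2) < phi1 / (2 * X1) := by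
    rw [div_lt_div_iff₀ (by positivity) hphi1, div_lt_div_iff₀ (by positivity) (by positivity)]
    constructor <;> intro h <;> linarith
  have upper_bound : phi2 / phi1 < (2 * X2 - 1) / (2 * X1) ↔
      phi2 / (2 * X2 - 1) < phi1 / (2 * X1) := by
    rw [div_lt_div_iff₀ hphi1 (by positivity), div_lt_div_iff₀ hD (by positivity),
      mul_comm phi1]
  simp only [player1_gain, player2_gain, lower_bound, upper_bound]
  constructor
  · rintro ⟨nu, -, hswitch, h1, h2⟩
    exact ⟨hswitch.trans h1, h2.trans h1⟩
  · rintro ⟨hl, hu⟩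
    obtain ⟨nu, hnu, hnu'⟩ := exists_between (max_lt hl hu)
    obtain ⟨hswitch, h2⟩ := max_lt_iff.mp hnu
    have hpos : 0 < phi2 / (2 * X2 - 1) := by positivity
    have hle : phi1 / (2 * X1) ≤ phi1 := div_le_self hphi1.le (by linarith)
    exact ⟨nu, ⟨by linarith, by linarith⟩, hswitch, hnu', h2⟩
end

section
/- Let φ₁, φ₂ > 0, X₁ ≥ 1, and 0 < X₂ < 1. There exists ν ∈ (−φ₂, φ₁) satisfying ν ≥ (φ₁ − X₁X₂φ₂)/(X₁X₂ + 1), φ₁(1 − 1/(2X₁)) < φ₁ − ν, and φ₂ < (φ₂ + ν)·X₂/2 if and only if (−X₁X₂ + 2X₁ − 1)/(2X₁²X₂) < φ₂/φ₁ < X₂/(2X₁(2 − X₂)). -/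
/-- **Region 2 (Case 1 → Case 1') condition.** With `X₁ ≥ 1` and `0 < X₂ < 1`,
a contest transfer `ν ≥ α₂` strictly increasing both Players' payoffs exists iff
`(−X₁X₂ + 2X₁ − 1)/(2X₁²X₂) < φ₂/φ₁ < X₂/(2X₁(2 − X₂))`. -/
theorem region2_mutually_beneficial_iff (phi1 phi2 X1 X2 : ℝ)
    (hphi1 : 0 < phi1) (hphi2 : 0 < phi2) (hX1 : 1 ≤ X1)
    (hX2 : 0 < X2) (hX2' : X2 < 1) :
    (∃ nu ∈ Set.Ioo (-phi2) phi1,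
      (phi1 - X1 * X2 * phi2) / (X1 * X2 + 1) ≤ nu ∧
      phi1 * (1 - 1 / (2 * X1)) < phi1 - nu ∧
      phi2 < (phi2 + nu) * X2 / 2) ↔
    ((-(X1 * X2) + 2 * X1 - 1) / (2 * X1 ^ 2 * X2) < phi2 / phi1 ∧
      phi2 / phi1 < X2 / (2 * X1 * (2 - X2))) := by
  have hX1pos : 0 < X1 := by linarith
  have h2X : 0 < 2 - X2 := by linarith
  have hlower : (-(X1 * X2) + 2 * X1 - 1) / (2 * X1 ^ 2 * X2) < phi2 / phi1 ↔
      (phi1 - X1 * X2 * phi2) / (X1 * X2 + 1) < phi1 / (2 * X1) := by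
    rw [div_lt_div_iff₀ (by positivity) hphi1, div_lt_div_iff₀ (by positivity) (by positivity)]
    constructor <;> intro h <;> linarith
  have hupper : phi2 / phi1 < X2 / (2 * X1 * (2 - X2)) ↔
      phi2 * (2 - X2) / X2 < phi1 / (2 * X1) := by
    rw [div_lt_div_iff₀ hphi1 (by positivity), div_lt_div_iff₀ hX2 (by positivity)]
    constructor <;> intro h <;> linarith
  have hpayoff1 (nu : ℝ) :
      phi1 * (1 - 1 / (2 * X1)) < phi1 - nu ↔ nu < phi1 / (2 * X1) := by
    have h : phi1 * (1 - 1 / (2 * X1)) = phi1 - phi1 / (2 * X1) := by ring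
    rw [h, sub_lt_sub_iff_left]
  have hpayoff2 (nu : ℝ) :
      phi2 < (phi2 + nu) * X2 / 2 ↔ phi2 * (2 - X2) / X2 < nu := by
    rw [div_lt_iff₀ hX2]
    constructor <;> intro h <;> linarith
  simp only [hlower, hupper, hpayoff1, hpayoff2]
  constructor
  · rintro ⟨nu, -, h1, h2, h3⟩
    exact ⟨h1.trans_lt h2, h3.trans h2⟩
  · rintro ⟨h1, h2⟩
    obtain ⟨nu, hnu, hnu'⟩ := exists_between (max_lt h1 h2)
    rw [max_lt_iff] at hnu
    have hpos : 0 < phi2 * (2 - X2) / X2 := by positivity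
    have hle : phi1 / (2 * X1) ≤ phi1 := div_le_self hphi1.le (by linarith)
    exact ⟨nu, ⟨by linarith [hnu.2], by linarith⟩, hnu.1.le, hnu', hnu.2⟩
end

section
/- Let φ₁, φ₂ > 0, 0 < X₁ < 1, and X₂ ≥ 1. There exists ν ∈ (−φ₂, φ₁) satisfying ν > (X₂φ₁ − X₁φ₂)/(X₁ + X₂), φ₁·X₁/2 < φ₁ − ν, and φ₂ < (φ₂ + ν)(1 − 1/(2X₂)) if and only if (1/2)(X₁ + X₂ − 2) < φ₂/φ₁ < (1/2)(2 − X₁)(2X₂ − 1). -/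
/-- **Region 3 (Case 1 → Case 1') condition.** With `0 < X₁ < 1` and `X₂ ≥ 1`,
a contest transfer `ν > α₁` strictly increasing both Players' payoffs exists iff
`(1/2)(X₁ + X₂ − 2) < φ₂/φ₁ < (1/2)(2 − X₁)(2X₂ − 1)`. -/
theorem region3_mutually_beneficial_iff (phi1 phi2 X1 X2 : ℝ)
    (hphi1 : 0 < phi1) (hphi2 : 0 < phi2) (hX1 : 0 < X1) (hX1' : X1 < 1)
    (hX2 : 1 ≤ X2) :
    (∃ nu ∈ Set.Ioo (-phi2) phi1,
      (X2 * phi1 - X1 * phi2) / (X1 + X2) < nu ∧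
      phi1 * X1 / 2 < phi1 - nu ∧
      phi2 < (phi2 + nu) * (1 - 1 / (2 * X2))) ↔
    ((1 / 2) * (X1 + X2 - 2) < phi2 / phi1 ∧
      phi2 / phi1 < (1 / 2) * (2 - X1) * (2 * X2 - 1)) := by
  have hS : 0 < X1 + X2 := by linarith
  have hD : 0 < 2 * X2 - 1 := by linarith
  have hX2pos : 0 < X2 := by linarith
  have gain_iff (nu : ℝ) :
      phi2 < (phi2 + nu) * (1 - 1 / (2 * X2)) ↔ phi2 / (2 * X2 - 1) < nu := by
    have h : (phi2 + nu) * (1 - 1 / (2 * X2)) = (phi2 + nu) * (2 * X2 - 1) / (2 * X2) := by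
      field_simp
    rw [h, lt_div_iff₀ (by positivity), div_lt_iff₀ hD]
    constructor <;> intro h <;> linarith
  have lower_iff : (1 / 2) * (X1 + X2 - 2) < phi2 / phi1 ↔
      (X2 * phi1 - X1 * phi2) / (X1 + X2) < phi1 * (2 - X1) / 2 := by
    rw [lt_div_iff₀ hphi1, div_lt_iff₀ hS, ← mul_lt_mul_iff_right₀ hX1]
    constructor <;> intro h <;> linarith
  have upper_iff : phi2 / phi1 < (1 / 2) * (2 - X1) * (2 * X2 - 1) ↔
      phi2 / (2 * X2 - 1) < phi1 * (2 - X1) / 2 := by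
    rw [div_lt_iff₀ hphi1, div_lt_iff₀ hD]
    constructor <;> intro h <;> linarith
  rw [lower_iff, upper_iff]
  constructor
  · rintro ⟨nu, -, h1, h2, h3⟩
    have h3 := (gain_iff nu).1 h3
    constructor <;> linarith
  · rintro ⟨h1, h2⟩
    obtain ⟨nu, hl, hu⟩ := exists_between (max_lt h1 h2)
    obtain ⟨hl1, hl2⟩ := max_lt_iff.1 hl
    have hpos : 0 < phi2 / (2 * X2 - 1) := by positivity
    have hprod : 0 < phi1 * X1 := by positivity
    exact ⟨nu, ⟨by linarith, by linarith⟩, hl1, by linarith, (gain_iff nu).2 hl2⟩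
end

section
/- Let φ₁, φ₂ > 0, 0 < X₁ < 1, and X₂ ≥ 1. There exists ν ∈ (−φ₂, φ₁) satisfying ν > (X₂φ₁ − X₁φ₂)/(X₁ + X₂), (1/2)√(X₁φ₁φ₂/X₂) < φ₁ − ν, and φ₂(1 − 1/(2X₂)) + (1/2)√(X₁φ₁φ₂/X₂) < (φ₂ + ν)(1 − 1/(2X₂)) if and only if max{ (X₂φ₁ − X₁φ₂)/(X₁ + X₂), √(X₁X₂φ₁φ₂)/(2X₂ − 1) } < φ₁ − (1/2)√(X₁φ₁φ₂/X₂). -/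
/-- **Region 3 (Case 2 → Case 1') condition.** With `0 < X₁ < 1` and `X₂ ≥ 1`,
a contest transfer `ν > α₁` strictly increasing both Players' payoffs (from
their Case-2 pre-transfer payoffs) exists iff
`max{α₁, √(X₁X₂φ₁φ₂)/(2X₂ − 1)} < φ₁ − (1/2)√(X₁φ₁φ₂/X₂)`. -/
theorem region3_case2_mutually_beneficial_iff (phi1 phi2 X1 X2 : ℝ)
    (hphi1 : 0 < phi1) (hphi2 : 0 < phi2) (hX1 : 0 < X1) (hX1' : X1 < 1)
    (hX2 : 1 ≤ X2) :
    (∃ nu ∈ Set.Ioo (-phi2) phi1,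
      (X2 * phi1 - X1 * phi2) / (X1 + X2) < nu ∧
      (1 / 2) * Real.sqrt (X1 * phi1 * phi2 / X2) < phi1 - nu ∧
      phi2 * (1 - 1 / (2 * X2)) + (1 / 2) * Real.sqrt (X1 * phi1 * phi2 / X2) <
        (phi2 + nu) * (1 - 1 / (2 * X2))) ↔
    max ((X2 * phi1 - X1 * phi2) / (X1 + X2))
        (Real.sqrt (X1 * X2 * phi1 * phi2) / (2 * X2 - 1)) <
      phi1 - (1 / 2) * Real.sqrt (X1 * phi1 * phi2 / X2) := by
  have hX2pos : 0 < X2 := by linarith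
  have hd : 0 < 2 * X2 - 1 := by linarith
  have hsqrt : Real.sqrt (X1 * X2 * phi1 * phi2) =
      X2 * Real.sqrt (X1 * phi1 * phi2 / X2) := by
    rw [show X1 * X2 * phi1 * phi2 = X2 ^ 2 * (X1 * phi1 * phi2 / X2) by field_simp,
      Real.sqrt_mul (sq_nonneg X2), Real.sqrt_sq hX2pos.le]
  rw [hsqrt]
  have hS : 0 ≤ Real.sqrt (X1 * phi1 * phi2 / X2) := Real.sqrt_nonneg _
  generalize Real.sqrt (X1 * phi1 * phi2 / X2) = S at hS ⊢
  have gain_iff (nu : ℝ) :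
      phi2 * (1 - 1 / (2 * X2)) + 1 / 2 * S < (phi2 + nu) * (1 - 1 / (2 * X2)) ↔
        X2 * S / (2 * X2 - 1) < nu := by
    have h : (phi2 + nu) * (1 - 1 / (2 * X2)) - (phi2 * (1 - 1 / (2 * X2)) + 1 / 2 * S) =
        (nu * (2 * X2 - 1) - X2 * S) / (2 * X2) := by
      field_simp
      ring
    rw [← sub_pos, h, div_pos_iff_of_pos_right (by linarith), sub_pos, div_lt_iff₀ hd]
  simp only [gain_iff]
  constructor
  · rintro ⟨nu, -, hα, h1, h2⟩
    exact max_lt (by linarith) (by linarith)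
  · intro h
    obtain ⟨nu, hmax, hnu⟩ := exists_between h
    obtain ⟨hα, h2⟩ := max_lt_iff.mp hmax
    have h0 : 0 ≤ X2 * S / (2 * X2 - 1) := by positivity
    exact ⟨nu, ⟨by linarith, by linarith⟩, hα, by linarith, h2⟩
end

section
/- Let φ₁, φ₂ > 0, 0 < X₁ < 1, 0 < X₂ < 1, and X₁ + X₂ ≥ 1. There exists ν ∈ (−φ₂, φ₁) satisfying ν ≥ (φ₁ − X₁X₂φ₂)/(X₁X₂ + 1), φ₁·X₁/2 < φ₁ − ν, and φ₂ < (φ₂ + ν)·X₂/2 if and only if (X₁X₂ − 2X₂ + 1)/(2X₂) < φ₂/φ₁ < (2 − X₁)X₂/(2(2 − X₂)). -/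
/-- The lower bound `α₂` lies below Player 1's break-even transfer iff the valuation ratio
exceeds the left threshold. -/
lemma transfer_threshold_lt_iff {phi1 phi2 X1 X2 : ℝ} (hphi1 : 0 < phi1)
    (hX1 : 0 < X1) (hX2 : 0 < X2) :
    (phi1 - X1 * X2 * phi2) / (X1 * X2 + 1) < phi1 * (1 - X1 / 2) ↔
      (X1 * X2 - 2 * X2 + 1) / (2 * X2) < phi2 / phi1 := by
  rw [div_lt_iff₀ (by positivity), div_lt_div_iff₀ (by positivity) hphi1,
    ← mul_lt_mul_iff_right₀ (b := (X1 * X2 - 2 * X2 + 1) * phi1) (half_pos hX1)]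
  constructor <;> intro h <;> linarith

/-- Player 2's break-even transfer lies below Player 1's iff the valuation ratio is below the
right threshold. -/
lemma break_even_lt_iff {phi1 phi2 X1 X2 : ℝ} (hphi1 : 0 < phi1)
    (hX2 : 0 < X2) (hX2' : X2 < 1) :
    phi2 * (2 - X2) / X2 < phi1 * (1 - X1 / 2) ↔
      phi2 / phi1 < (2 - X1) * X2 / (2 * (2 - X2)) := by
  rw [div_lt_iff₀ hX2, div_lt_div_iff₀ hphi1 (by linarith)]
  constructor <;> intro h <;> linarith

/-- **Region 4 (Case 1 → Case 1') condition.** With `0 < X₁ < 1`, `0 < X₂ < 1`,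
and `X₁ + X₂ ≥ 1`, a contest transfer `ν ≥ α₂` strictly increasing both
Players' payoffs exists iff
`(X₁X₂ − 2X₂ + 1)/(2X₂) < φ₂/φ₁ < (2 − X₁)X₂/(2(2 − X₂))`. -/
theorem region4_mutually_beneficial_iff (phi1 phi2 X1 X2 : ℝ)
    (hphi1 : 0 < phi1) (hphi2 : 0 < phi2) (hX1 : 0 < X1) (hX1' : X1 < 1)
    (hX2 : 0 < X2) (hX2' : X2 < 1) (hsum : 1 ≤ X1 + X2) :
    (∃ nu ∈ Set.Ioo (-phi2) phi1,
      (phi1 - X1 * X2 * phi2) / (X1 * X2 + 1) ≤ nu ∧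
      phi1 * X1 / 2 < phi1 - nu ∧
      phi2 < (phi2 + nu) * X2 / 2) ↔
    ((X1 * X2 - 2 * X2 + 1) / (2 * X2) < phi2 / phi1 ∧
      phi2 / phi1 < (2 - X1) * X2 / (2 * (2 - X2))) := by
  rw [← transfer_threshold_lt_iff hphi1 hX1 hX2, ← break_even_lt_iff hphi1 hX2 hX2']
  constructor
  · rintro ⟨nu, -, hα, h1, h2⟩
    have hU : nu < phi1 * (1 - X1 / 2) := by linarith
    refine ⟨hα.trans_lt hU, lt_trans ?_ hU⟩
    rw [div_lt_iff₀ hX2]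
    linarith
  · rintro ⟨hα, hβ⟩
    obtain ⟨nu, hlow, hU⟩ := exists_between (max_lt hα hβ)
    obtain ⟨hαnu, hβnu⟩ := max_lt_iff.mp hlow
    have hβ_pos : 0 < phi2 * (2 - X2) / X2 := div_pos (mul_pos hphi2 (by linarith)) hX2
    have hpos : 0 < phi1 * X1 := mul_pos hphi1 hX1
    rw [div_lt_iff₀ hX2] at hβnu
    exact ⟨nu, ⟨by linarith [div_lt_iff₀ hX2 |>.mpr hβnu], by linarith⟩, hαnu.le,
      by linarith, by linarith⟩
end

section
/- Let φ₁, φ₂, X₁, X₂ be positive reals with X₁φ₂ < X₂φ₁ and 0 < 1 − √(X₁X₂φ₁/φ₂) ≤ X₂. Then 1 − 1/(2X₂) + (1/2)·√(X₁/(X₂φ₁φ₂))·(φ₁ − φ₂) > 0; equivalently, the derivative at ν = 0 of the Case-2 collective payoff W₂(ν) = (1 − 1/(2X₂))(φ₂ + ν) + √(X₁(φ₁−ν)(φ₂+ν)/X₂) is strictly positive. -/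
/-- The Case-2 collective payoff as a function of the contest transfer `ν`. -/
noncomputable def case2Collective (phi1 phi2 X1 X2 nu : ℝ) : ℝ :=
  (1 - 1 / (2 * X2)) * (phi2 + nu) +
    Real.sqrt (X1 * (phi1 - nu) * (phi2 + nu) / X2)

theorem sqrt_marginal_eq {phi1 phi2 X1 X2 : ℝ} (hphi1 : 0 < phi1) (hphi2 : 0 < phi2)
    (hX2 : 0 < X2) :
    Real.sqrt (X1 / (X2 * phi1 * phi2)) =
      Real.sqrt (X1 * X2 * phi1 / phi2) / (X2 * phi1) := by
  have h : X1 / (X2 * phi1 * phi2) = X1 * X2 * phi1 / phi2 / (X2 * phi1) ^ 2 := by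
    field_simp
  rw [h, Real.sqrt_div' _ (by positivity), Real.sqrt_sq (by positivity)]

theorem hasDerivAt_case2Collective_zero {phi1 phi2 X1 X2 : ℝ}
    (hphi1 : 0 < phi1) (hphi2 : 0 < phi2) (hX1 : 0 < X1) (hX2 : 0 < X2) :
    HasDerivAt (case2Collective phi1 phi2 X1 X2)
      (1 - 1 / (2 * X2) +
        (1 / 2) * Real.sqrt (X1 / (X2 * phi1 * phi2)) * (phi1 - phi2)) 0 := by
  have hrad : HasDerivAt (fun nu : ℝ => X1 * (phi1 - nu) * (phi2 + nu) / X2)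
      (X1 * (phi1 - phi2) / X2) 0 := by
    have h := ((((hasDerivAt_id (0 : ℝ)).const_sub phi1).const_mul X1).mul
      ((hasDerivAt_id (0 : ℝ)).const_add phi2)).div_const X2
    refine h.congr_deriv ?_
    simp only [id]
    ring
  have hpos : 0 < X1 * (phi1 - 0) * (phi2 + 0) / X2 := by
    rw [sub_zero, add_zero]
    positivity
  have hsum := (((hasDerivAt_id (0 : ℝ)).const_add phi2).const_mul (1 - 1 / (2 * X2))).add
    (hrad.sqrt hpos.ne')
  refine hsum.congr_deriv ?_
  have hs : 0 < Real.sqrt (X1 / (X2 * phi1 * phi2)) := Real.sqrt_pos.mpr (by positivity)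
  have hsq : Real.sqrt (X1 / (X2 * phi1 * phi2)) ^ 2 = X1 / (X2 * phi1 * phi2) :=
    Real.sq_sqrt (by positivity)
  have hroot : Real.sqrt (X1 * (phi1 - 0) * (phi2 + 0) / X2) =
      Real.sqrt (X1 / (X2 * phi1 * phi2)) * (phi1 * phi2) := by
    have h : X1 * (phi1 - 0) * (phi2 + 0) / X2 =
        X1 / (X2 * phi1 * phi2) * (phi1 * phi2) ^ 2 := by
      rw [sub_zero, add_zero]
      field_simp
    rw [h, Real.sqrt_mul' _ (by positivity), Real.sqrt_sq (by positivity)]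
  rw [hroot]
  generalize Real.sqrt (X1 / (X2 * phi1 * phi2)) = s at hs hsq
  have hX1_eq : X1 = s ^ 2 * (X2 * phi1 * phi2) := by
    rw [hsq]
    field_simp
  rw [hX1_eq]
  field_simp

/-- In Case 2 (`X₁φ₂ < X₂φ₁` and `0 < 1 − √(X₁X₂φ₁/φ₂) ≤ X₂`), the quantity
`1 − 1/(2X₂) + (1/2)√(X₁/(X₂φ₁φ₂))(φ₁ − φ₂)` is strictly positive;
equivalently, the derivative of the Case-2 collective payoff at `ν = 0` is
strictly positive. -/
theorem case2_collective_deriv_pos (phi1 phi2 X1 X2 : ℝ)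
    (hphi1 : 0 < phi1) (hphi2 : 0 < phi2) (hX1 : 0 < X1) (hX2 : 0 < X2)
    (hratio : X1 * phi2 < X2 * phi1)
    (hlo : 0 < 1 - Real.sqrt (X1 * X2 * phi1 / phi2))
    (hhi : 1 - Real.sqrt (X1 * X2 * phi1 / phi2) ≤ X2) :
    0 < 1 - 1 / (2 * X2) +
        (1 / 2) * Real.sqrt (X1 / (X2 * phi1 * phi2)) * (phi1 - phi2) ∧
    0 < deriv (case2Collective phi1 phi2 X1 X2) 0 := by
  have hmain : 0 < 1 - 1 / (2 * X2) +
      (1 / 2) * Real.sqrt (X1 / (X2 * phi1 * phi2)) * (phi1 - phi2) := by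
    rw [sqrt_marginal_eq hphi1 hphi2 hX2]
    have hsq : Real.sqrt (X1 * X2 * phi1 / phi2) ^ 2 = X1 * X2 * phi1 / phi2 :=
      Real.sq_sqrt (by positivity)
    generalize Real.sqrt (X1 * X2 * phi1 / phi2) = a at hhi hsq
    have hlt : a * phi2 < X2 * phi1 := by
      refine lt_of_pow_lt_pow_left₀ 2 (by positivity) ?_
      calc (a * phi2) ^ 2 = X2 * phi1 * (X1 * phi2) := by
            rw [mul_pow, hsq]
            field_simp
        _ < X2 * phi1 * (X2 * phi1) := by gcongr
        _ = (X2 * phi1) ^ 2 := by ring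
    have hnum : 0 < (2 * X2 - 1 + a) * phi1 - a * phi2 := by
      nlinarith [mul_le_mul_of_nonneg_right hhi hphi1.le]
    have heq : 1 - 1 / (2 * X2) + 1 / 2 * (a / (X2 * phi1)) * (phi1 - phi2) =
        ((2 * X2 - 1 + a) * phi1 - a * phi2) / (2 * X2 * phi1) := by
      field_simp
      ring
    rw [heq]
    positivity
  refine ⟨hmain, ?_⟩
  rwa [(hasDerivAt_case2Collective_zero hphi1 hphi2 hX1 hX2).deriv]
end

section
/- Let φ₁, φ₂, X₁, X₂ be positive reals and let W₃(ν) = (1/2)X₁(φ₁−ν) + (1/2)X₂(φ₂+ν) + √(X₁X₂(φ₁−ν)(φ₂+ν)) for ν ∈ (−φ₂, φ₁). (i) If X₁φ₂ ≤ X₂φ₁, then W₃′(0) ≥ 0. (ii) The point ν** = (X₂φ₁ − X₁φ₂)/(X₁ + X₂) lies in (−φ₂, φ₁), satisfies X₁(φ₂ + ν**) = X₂(φ₁ − ν**), and is the unique zero of W₃′ on (−φ₂, φ₁), so it is the unique maximizer of W₃. -/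
/-- The Case-3 collective payoff as a function of the contest transfer `ν`. -/
noncomputable def case3Collective (phi1 phi2 X1 X2 nu : ℝ) : ℝ :=
  (1 / 2) * X1 * (phi1 - nu) + (1 / 2) * X2 * (phi2 + nu) +
    Real.sqrt (X1 * X2 * (phi1 - nu) * (phi2 + nu))

/-- The derivative of the collective payoff, factored so that its sign is that of
`X₂(φ₁ − ν) − X₁(φ₂ + ν)`. -/
lemma hasDerivAt_case3Collective {phi1 phi2 X1 X2 nu : ℝ} (hX1 : 0 < X1) (hX2 : 0 < X2)
    (hnu : nu ∈ Set.Ioo (-phi2) phi1) :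
    HasDerivAt (case3Collective phi1 phi2 X1 X2)
      ((√(X2 * (phi1 - nu)) - √(X1 * (phi2 + nu))) *
        ((√(X2 * (phi2 + nu)) + √(X1 * (phi1 - nu))) /
          (2 * √((phi1 - nu) * (phi2 + nu))))) nu := by
  have hp : 0 < phi1 - nu := by linarith [hnu.2]
  have hq : 0 < phi2 + nu := by linarith [hnu.1]
  have h1 : HasDerivAt (fun x : ℝ => phi1 - x) (-1) nu := (hasDerivAt_id nu).const_sub phi1
  have h2 : HasDerivAt (fun x : ℝ => phi2 + x) 1 nu := (hasDerivAt_id nu).const_add phi2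
  have hpos : 0 < X1 * X2 * (phi1 - nu) * (phi2 + nu) := by positivity
  have h := ((h1.const_mul (1 / 2 * X1)).add (h2.const_mul (1 / 2 * X2))).add
    (((h1.const_mul (X1 * X2)).mul h2).sqrt hpos.ne')
  refine HasDerivAt.congr_deriv (f := case3Collective phi1 phi2 X1 X2) h ?_
  simp only [Pi.mul_apply]
  generalize phi1 - nu = p at *
  generalize phi2 + nu = q at *
  rw [Real.sqrt_mul (by positivity), Real.sqrt_mul (by positivity), Real.sqrt_mul hX1.le,
    Real.sqrt_mul hX2.le, Real.sqrt_mul hX2.le, Real.sqrt_mul hX1.le, Real.sqrt_mul hX1.le,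
    Real.sqrt_mul hp.le]
  have ha := Real.sqrt_pos.2 hX1
  have hb := Real.sqrt_pos.2 hX2
  have hc := Real.sqrt_pos.2 hp
  have hd := Real.sqrt_pos.2 hq
  have ha2 := Real.sq_sqrt hX1.le
  have hb2 := Real.sq_sqrt hX2.le
  have hc2 := Real.sq_sqrt hp.le
  have hd2 := Real.sq_sqrt hq.le
  generalize √X1 = a at *
  generalize √X2 = b at *
  generalize √p = c at *
  generalize √q = d at *
  subst ha2 hb2 hc2 hd2
  field_simp
  ring

/-- A critical point of the collective payoff equalizes the budget-to-valuation ratios,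
and conversely. -/
lemma deriv_case3Collective_eq_zero_iff {phi1 phi2 X1 X2 nu : ℝ} (hX1 : 0 < X1) (hX2 : 0 < X2)
    (hnu : nu ∈ Set.Ioo (-phi2) phi1) :
    deriv (case3Collective phi1 phi2 X1 X2) nu = 0 ↔ X1 * (phi2 + nu) = X2 * (phi1 - nu) := by
  have hp : 0 < phi1 - nu := by linarith [hnu.2]
  have hq : 0 < phi2 + nu := by linarith [hnu.1]
  have hfactor : (√(X2 * (phi2 + nu)) + √(X1 * (phi1 - nu))) /
      (2 * √((phi1 - nu) * (phi2 + nu))) ≠ 0 := by positivity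
  rw [(hasDerivAt_case3Collective hX1 hX2 hnu).deriv, mul_eq_zero, or_iff_left hfactor,
    sub_eq_zero, Real.sqrt_inj (by positivity) (by positivity), eq_comm]

/-- The collective payoff at a transfer that equalizes the budget-to-valuation ratios. -/
lemma case3Collective_of_ratio_eq {phi1 phi2 X1 X2 nu : ℝ} (hX1 : 0 < X1)
    (hnu : nu ∈ Set.Ioo (-phi2) phi1) (h : X1 * (phi2 + nu) = X2 * (phi1 - nu)) :
    case3Collective phi1 phi2 X1 X2 nu = (X1 + X2) * (phi1 + phi2) / 2 := by
  have hq : 0 < phi2 + nu := by linarith [hnu.1]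
  have hsq : X1 * X2 * (phi1 - nu) * (phi2 + nu) = (X1 * (phi2 + nu)) ^ 2 := by
    linear_combination (-X1 * (phi2 + nu)) * h
  rw [case3Collective, hsq, Real.sqrt_sq (by positivity)]
  linear_combination h / 2

/-- Away from equal budget-to-valuation ratios the AM-GM inequality is strict. -/
lemma case3Collective_lt_of_ratio_ne {phi1 phi2 X1 X2 nu : ℝ} (hX1 : 0 < X1) (hX2 : 0 < X2)
    (hnu : nu ∈ Set.Ioo (-phi2) phi1) (h : X1 * (phi2 + nu) ≠ X2 * (phi1 - nu)) :
    case3Collective phi1 phi2 X1 X2 nu < (X1 + X2) * (phi1 + phi2) / 2 := by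
  have hp : 0 < phi1 - nu := by linarith [hnu.2]
  have hq : 0 < phi2 + nu := by linarith [hnu.1]
  have hsqrt : √(X1 * X2 * (phi1 - nu) * (phi2 + nu)) <
      (X1 * (phi2 + nu) + X2 * (phi1 - nu)) / 2 := by
    rw [Real.sqrt_lt' (by positivity)]
    linarith [sq_pos_of_ne_zero (sub_ne_zero.2 h)]
  unfold case3Collective
  linarith

/-- For the Case-3 collective payoff `W₃`: (i) if `X₁φ₂ ≤ X₂φ₁` then
`W₃′(0) ≥ 0`; (ii) `ν** = (X₂φ₁ − X₁φ₂)/(X₁ + X₂)` lies in `(−φ₂, φ₁)`,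
equalizes the post-transfer budget-to-valuation ratios, and is the unique zero
of `W₃′` on `(−φ₂, φ₁)`, hence the unique maximizer of `W₃` there. -/
theorem case3_collective_maximizer (phi1 phi2 X1 X2 : ℝ)
    (hphi1 : 0 < phi1) (hphi2 : 0 < phi2) (hX1 : 0 < X1) (hX2 : 0 < X2)
    (nustar : ℝ) (hnustar : nustar = (X2 * phi1 - X1 * phi2) / (X1 + X2)) :
    (X1 * phi2 ≤ X2 * phi1 → 0 ≤ deriv (case3Collective phi1 phi2 X1 X2) 0) ∧
    nustar ∈ Set.Ioo (-phi2) phi1 ∧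
    X1 * (phi2 + nustar) = X2 * (phi1 - nustar) ∧
    deriv (case3Collective phi1 phi2 X1 X2) nustar = 0 ∧
    (∀ nu ∈ Set.Ioo (-phi2) phi1,
      deriv (case3Collective phi1 phi2 X1 X2) nu = 0 → nu = nustar) ∧
    (∀ nu ∈ Set.Ioo (-phi2) phi1, nu ≠ nustar →
      case3Collective phi1 phi2 X1 X2 nu <
        case3Collective phi1 phi2 X1 X2 nustar) := by
  have hX : 0 < X1 + X2 := by positivity
  have hratio (nu : ℝ) : X1 * (phi2 + nu) = X2 * (phi1 - nu) ↔ nu = nustar := by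
    rw [hnustar, eq_div_iff hX.ne']
    constructor <;> intro h <;> linarith
  have hstar := (hratio nustar).2 rfl
  have hmem : nustar ∈ Set.Ioo (-phi2) phi1 := by
    rw [hnustar, Set.mem_Ioo, lt_div_iff₀ hX, div_lt_iff₀ hX]
    constructor <;> linarith [mul_pos hX1 hphi1, mul_pos hX2 hphi2, mul_pos hX2 hphi1,
      mul_pos hX1 hphi2]
  refine ⟨fun h => ?_, hmem, hstar, (deriv_case3Collective_eq_zero_iff hX1 hX2 hmem).2 hstar,
    fun nu hnu h => (hratio nu).1 ((deriv_case3Collective_eq_zero_iff hX1 hX2 hnu).1 h),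
    fun nu hnu hne => ?_⟩
  · rw [(hasDerivAt_case3Collective hX1 hX2 ⟨neg_lt_zero.2 hphi2, hphi1⟩).deriv]
    refine mul_nonneg (sub_nonneg.2 (Real.sqrt_le_sqrt ?_)) (by positivity)
    simpa using h
  · rw [case3Collective_of_ratio_eq hX1 hmem hstar]
    exact case3Collective_lt_of_ratio_ne hX1 hX2 hnu (mt (hratio nu).1 hne)
end
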